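/- arXiv:2006.06393 — 5 statements merged into one kernel-verified Lean document; each statement's English description precedes it below -/
import Mathlib

section
/- Each job g ∈ B1 is a-tight and satisfies Σ_{h∈G2} y_{gh} < w, and each job k ∈ B2 is c-tight and satisfies Σ_{h∈G1} y_{kh} < w. -/
open Finset

noncomputable section

/-- Feasibility for system `S`. -/
def FeasibleS {J M : Type*} [Fintype J] [Fintype M]
    (G1 G2 : Finset M) (b : J → M → ℕ) (a1 a2 : J → ℕ)
    (y : J → M → ℝ) (x1 x2 : J → ℝ) (r w : ℝ) : Prop :=
  (∀ h ∈ G1, ((∑ j, (b j h : ℝ)) - ((∑ j, (a2 j : ℝ)) - r) ≤ (∑ j, y j h)) ∧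
    ((∑ j, y j h) ≤ w)) ∧
  (∀ h ∈ G2, ((∑ j, (b j h : ℝ)) - ((∑ j, (a1 j : ℝ)) - r) ≤ (∑ j, y j h)) ∧
    ((∑ j, y j h) ≤ w)) ∧
  (∀ j, (∑ h, y j h) ≤ w) ∧
  (∀ j, ∀ h, 0 ≤ y j h ∧ y j h ≤ (b j h : ℝ)) ∧
  ((∑ j, x1 j) = r) ∧ ((∑ j, x2 j) = r) ∧
  (∀ j, x1 j + x2 j ≤ r) ∧
  (∀ j, 0 ≤ x1 j ∧ x1 j ≤ (a1 j : ℝ)) ∧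
  (∀ j, 0 ≤ x2 j ∧ x2 j ≤ (a2 j : ℝ)) ∧
  (∀ j, (∑ h ∈ G1, ((b j h : ℝ) - y j h)) + (a2 j : ℝ) - x2 j ≤ (∑ j', (a2 j' : ℝ)) - r) ∧
  (∀ j, (∑ h ∈ G2, ((b j h : ℝ) - y j h)) + (a1 j : ℝ) - x1 j ≤ (∑ j', (a1 j' : ℝ)) - r)

/-- Feasibility for the linear program `ℓp` associated with an optimal
LP-relaxation value `(rstar, wstar)`. -/
def FeasibleLP {J M : Type*} [Fintype J] [Fintype M]
    (G1 G2 : Finset M) (b : J → M → ℕ) (a1 a2 : J → ℕ)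
    (rstar wstar : ℝ)
    (y : J → M → ℝ) (x1 x2 : J → ℝ) (r w : ℝ) : Prop :=
  FeasibleS G1 G2 b a1 a2 y x1 x2 r w ∧
  w - r = (⌈wstar - rstar⌉ : ℝ) ∧ ((⌊rstar⌋ : ℝ) ≤ r)

theorem aux_delta {ι : Type*} [Fintype ι] (f : ι → ℝ) (e : ℝ) (he : 0 < e) :
    ∃ δ : ℝ, 0 < δ ∧ δ ≤ e ∧ ∀ i, 0 < f i → δ ≤ f i := by
  classical
  have h : ∀ s : Finset ι, ∃ δ : ℝ, 0 < δ ∧ δ ≤ e ∧ ∀ i ∈ s, 0 < f i → δ ≤ f i := by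
    intro s
    induction s using Finset.induction_on with
    | empty => exact ⟨e, he, le_refl _, by simp⟩
    | insert a s _ ih =>
      obtain ⟨δ, h0, h1, h2⟩ := ih
      by_cases ha : 0 < f a
      · refine ⟨min δ (f a), lt_min h0 ha, (min_le_left _ _).trans h1, ?_⟩
        intro i hi hfi
        rcases Finset.mem_insert.1 hi with rfl | hi
        · exact min_le_right _ _
        · exact (min_le_left _ _).trans (h2 i hi hfi)
      · refine ⟨δ, h0, h1, ?_⟩
        intro i hi hfi
        rcases Finset.mem_insert.1 hi with rfl | hi
        · exact absurd hfi ha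
        · exact h2 i hi hfi
  obtain ⟨δ, h0, h1, h2⟩ := h Finset.univ
  exact ⟨δ, h0, h1, fun i => h2 i (Finset.mem_univ i)⟩

/-- A Birkhoff-type matching in the support of `y`. -/
theorem aux_matching {J M : Type*} [Fintype J] [Fintype M] [DecidableEq J] [DecidableEq M]
    (y : J → M → ℝ) (w : ℝ) (hw : 0 < w) (hy : ∀ j h, 0 ≤ y j h)
    (hcol : ∀ h, ∑ j, y j h = w) (hrow : ∀ j, ∑ h, y j h ≤ w)
    (k : J) (G : Finset M) (hk : ∑ h ∈ G, y k h < w) :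
    ∃ D : J → M → ℝ, (∀ j h, 0 ≤ D j h) ∧ (∀ j h, 0 < D j h → 0 < y j h) ∧
      (∀ h, ∑ j, D j h = 1) ∧ (∀ j, ∑ h, D j h ≤ 1) ∧
      (∀ j, ∑ h, y j h = w → ∑ h, D j h = 1) ∧ ∑ h ∈ G, D k h = 0 := by
  let A : Matrix (J ⊕ M) (J ⊕ M) ℝ := Matrix.fromBlocks
    (Matrix.diagonal fun j => (w - ∑ h, y j h) / w) (fun j h => y j h / w)
    (fun h j => y j h / w) 0
  have e12 : ∀ j h, A (Sum.inl j) (Sum.inr h) = y j h / w := fun _ _ => rfl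
  have e21 : ∀ j h, A (Sum.inr h) (Sum.inl j) = y j h / w := fun _ _ => rfl
  have e22 : ∀ h h', A (Sum.inr h) (Sum.inr h') = 0 := fun _ _ => rfl
  have e11 : ∀ j j', A (Sum.inl j) (Sum.inl j') =
      if j = j' then (w - ∑ h, y j h) / w else 0 := fun _ _ => rfl
  have hA : A ∈ doublyStochastic ℝ (J ⊕ M) := by
    rw [mem_doublyStochastic_iff_sum]
    refine ⟨?_, ?_, ?_⟩
    · rintro (j | h) (j' | h')
      · rw [e11]; split_ifs
        · exact div_nonneg (by linarith [hrow j]) hw.le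
        · exact le_refl _
      · rw [e12]; exact div_nonneg (hy _ _) hw.le
      · rw [e21]; exact div_nonneg (hy _ _) hw.le
      · rw [e22]
    · rintro (j | h)
      · simp only [Fintype.sum_sum_type, e11, e12, ← Finset.sum_div, Finset.sum_ite_eq,
          Finset.mem_univ, if_true]
        field_simp; ring
      · simp only [Fintype.sum_sum_type, e21, e22, ← Finset.sum_div, hcol]
        simp [hw.ne']
    · rintro (j | h)
      · simp only [Fintype.sum_sum_type, e11, e21, ← Finset.sum_div, Finset.sum_ite_eq',
          Finset.mem_univ, if_true]
        field_simp; ring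
      · simp only [Fintype.sum_sum_type, e12, e22, ← Finset.sum_div, hcol]
        simp [hw.ne']
  obtain ⟨c, hc0, hc1, hcA⟩ := exists_eq_sum_perm_of_mem_doublyStochastic hA
  have hent : ∀ p q, A p q = ∑ σ, c σ * (σ.permMatrix ℝ) p q := by
    intro p q
    rw [← hcA]
    simp [Matrix.sum_apply]
  have hP0 : ∀ (σ : Equiv.Perm (J ⊕ M)) p q, 0 ≤ (σ.permMatrix ℝ) p q := fun σ =>
    (mem_doublyStochastic_iff_sum.1 permMatrix_mem_doublyStochastic).1
  obtain ⟨σ, hσ, hσk⟩ : ∃ σ, 0 < c σ ∧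
      ∑ h ∈ G, (σ.permMatrix ℝ) (Sum.inl k) (Sum.inr h) = 0 := by
    by_contra hcon
    push Not at hcon
    have h1 : ∀ σ, c σ ≤ c σ * ∑ h ∈ G, (σ.permMatrix ℝ) (Sum.inl k) (Sum.inr h) := by
      intro σ
      rcases (hc0 σ).eq_or_lt with h | h
      · rw [← h]; simp
      · have hne := hcon σ h
        obtain ⟨h', hG, hne'⟩ := Finset.exists_ne_zero_of_sum_ne_zero hne
        have h3 : (σ.permMatrix ℝ) (Sum.inl k) (Sum.inr h') = 1 := by
          rw [Equiv.Perm.permMatrix, PEquiv.toMatrix_apply] at hne' ⊢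
          split_ifs at hne' ⊢
          · rfl
          · exact absurd rfl hne'
        have h4 := Finset.single_le_sum
          (f := fun h => (σ.permMatrix ℝ) (Sum.inl k) (Sum.inr h)) (fun i _ => hP0 σ _ _) hG
        simp only [h3] at h4
        nlinarith
    have h2 : 1 ≤ ∑ h ∈ G, A (Sum.inl k) (Sum.inr h) := by
      simp only [hent]
      rw [Finset.sum_comm, ← hc1]
      refine Finset.sum_le_sum fun σ _ => ?_
      rw [← Finset.mul_sum]
      exact h1 σ
    simp only [e12, ← Finset.sum_div] at h2
    rw [le_div_iff₀ hw] at h2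
    linarith
  set P := σ.permMatrix ℝ with hP
  obtain ⟨hPn, hPr, hPc⟩ := mem_doublyStochastic_iff_sum.1
    (permMatrix_mem_doublyStochastic (R := ℝ) (σ := σ))
  have hsupp : ∀ p q, c σ * P p q ≤ A p q := by
    intro p q
    rw [hent]
    exact Finset.single_le_sum (f := fun σ => c σ * (σ.permMatrix ℝ) p q)
      (fun τ _ => mul_nonneg (hc0 τ) (hP0 τ _ _)) (Finset.mem_univ σ)
  have hzero : ∀ p q, A p q = 0 → P p q = 0 := by
    intro p q h
    have h1 := hsupp p q
    have h2 := hP0 σ p q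
    rw [h] at h1
    rcases h2.eq_or_lt with h3 | h3
    · exact h3.symm
    · have := mul_pos hσ h3
      exact absurd h1 (not_le.2 this)
  refine ⟨fun j h => P (Sum.inl j) (Sum.inr h), fun j h => hP0 σ _ _, ?_, ?_, ?_, ?_, hσk⟩
  · intro j h hpos
    rcases (hy j h).eq_or_lt with h0 | h0
    · have := hzero (Sum.inl j) (Sum.inr h) (by rw [e12, ← h0]; simp)
      exact absurd this hpos.ne'
    · exact h0
  · intro h
    have h1 := hPc (Sum.inr h)
    rw [Fintype.sum_sum_type] at h1
    rw [← h1]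
    have h2 : ∑ h', P (Sum.inr h') (Sum.inr h) = 0 :=
      Finset.sum_eq_zero fun h' _ => hzero _ _ (e22 _ _)
    change _ = _ + ∑ h', P (Sum.inr h') (Sum.inr h)
    rw [h2, add_zero]
  · intro j
    have h1 := hPr (Sum.inl j)
    rw [Fintype.sum_sum_type] at h1
    have h2 : 0 ≤ ∑ j', P (Sum.inl j) (Sum.inl j') :=
      Finset.sum_nonneg fun j' _ => hP0 σ _ _
    change _ ≤ _
    linarith
  · intro j hj
    have h1 := hPr (Sum.inl j)
    rw [Fintype.sum_sum_type] at h1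
    have h2 : ∑ j', P (Sum.inl j) (Sum.inl j') = 0 :=
      Finset.sum_eq_zero fun j' _ => hzero _ _ (by rw [e11, hj]; simp)
    change _ = _
    linarith

/-- The perturbation step. -/
theorem aux_perturb {J M : Type*} [Fintype J] [Fintype M] [DecidableEq J] [DecidableEq M]
    (G1 G2 : Finset M)
    (hdisj : Disjoint G1 G2) (hcover : G1 ∪ G2 = Finset.univ)
    (b : J → M → ℕ) (a1 a2 : J → ℕ) (rstar wstar : ℝ)
    (y : J → M → ℝ) (x1 x2 : J → ℝ) (r w : ℝ)
    (hfeas : FeasibleLP G1 G2 b a1 a2 rstar wstar y x1 x2 r w)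
    (hopt : ∀ y' x1' x2' r' w',
      FeasibleLP G1 G2 b a1 a2 rstar wstar y' x1' x2' r' w' → r ≤ r')
    (hr : (⌊rstar⌋ : ℝ) < r) (hw : 0 < w)
    (hsat1 : ∀ h ∈ G1, ((∑ j, y j h) = w) ∧
      (w = (∑ j, (b j h : ℝ)) - ((∑ j, (a2 j : ℝ)) - r)))
    (hsat2 : ∀ h ∈ G2, ((∑ j, y j h) = w) ∧
      (w = (∑ j, (b j h : ℝ)) - ((∑ j, (a1 j : ℝ)) - r)))
    (g k : J) (hg : 0 < x1 g) (hk : 0 < x2 k)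
    (hx : ∀ j, x1 j + x2 j = r → j = g ∨ j = k)
    (hga : (∑ h ∈ G2, ((b g h : ℝ) - y g h)) + (a1 g : ℝ) - x1 g < (∑ j, (a1 j : ℝ)) - r ∨
      ∑ h ∈ G2, y g h = 0)
    (hkc : (∑ h ∈ G1, ((b k h : ℝ) - y k h)) + (a2 k : ℝ) - x2 k < (∑ j, (a2 j : ℝ)) - r ∨
      ∑ h ∈ G1, y k h < w) : False := by
  obtain ⟨⟨F1, F2, F3, F4, F5, F6, F7, F8, F9, F10, F11⟩, hwr, -⟩ := hfeas
  have hsplit : ∀ f : M → ℝ, ∑ h, f h = ∑ h ∈ G1, f h + ∑ h ∈ G2, f h := by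
    intro f
    rw [← hcover, Finset.sum_union hdisj]
  have hcol : ∀ h, ∑ j, y j h = w := by
    intro h
    have : h ∈ G1 ∪ G2 := by rw [hcover]; exact Finset.mem_univ h
    rcases Finset.mem_union.1 this with h1 | h1
    · exact (hsat1 h h1).1
    · exact (hsat2 h h1).1
  obtain ⟨D, D0, Ds, Dc, Dr, Dt, hkc'⟩ : ∃ D : J → M → ℝ, (∀ j h, 0 ≤ D j h) ∧
      (∀ j h, 0 < D j h → 0 < y j h) ∧
      (∀ h, ∑ j, D j h = 1) ∧ (∀ j, ∑ h, D j h ≤ 1) ∧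
      (∀ j, ∑ h, y j h = w → ∑ h, D j h = 1) ∧
      ((∑ h ∈ G1, ((b k h : ℝ) - y k h)) + (a2 k : ℝ) - x2 k < (∑ j, (a2 j : ℝ)) - r ∨
        ∑ h ∈ G1, D k h = 0) := by
    rcases hkc with h | h
    · obtain ⟨D, p1, p2, p3, p4, p5, -⟩ := aux_matching y w hw (fun j h => (F4 j h).1) hcol F3
        k ∅ (by simpa using hw)
      exact ⟨D, p1, p2, p3, p4, p5, Or.inl h⟩
    · obtain ⟨D, p1, p2, p3, p4, p5, p6⟩ := aux_matching y w hw (fun j h => (F4 j h).1) hcol F3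
        k G1 h
      exact ⟨D, p1, p2, p3, p4, p5, Or.inr p6⟩
  have D1 : ∀ j h, D j h ≤ 1 := fun j h =>
    (Finset.single_le_sum (f := fun h => D j h) (fun i _ => D0 j i) (Finset.mem_univ h)).trans
      (Dr j)
  have hga' : (∑ h ∈ G2, ((b g h : ℝ) - y g h)) + (a1 g : ℝ) - x1 g < (∑ j, (a1 j : ℝ)) - r ∨
      ∑ h ∈ G2, D g h = 0 := by
    refine hga.imp_right fun h => ?_
    rw [Finset.sum_eq_zero_iff_of_nonneg (fun i _ => (F4 g i).1)] at h
    refine Finset.sum_eq_zero fun i hi => ?_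
    by_contra hne
    exact (Ds g i (lt_of_le_of_ne (D0 g i) (Ne.symm hne))).ne' (h i hi)
  obtain ⟨δ1, p1, q1, s1⟩ := aux_delta (fun p : J × M => y p.1 p.2) (r - ⌊rstar⌋) (by linarith)
  obtain ⟨δ2, p2, q2, s2⟩ := aux_delta (fun j : J => w - ∑ h, y j h) δ1 p1
  obtain ⟨δ3, p3, q3, s3⟩ := aux_delta (fun j : J => r - (x1 j + x2 j)) δ2 p2
  obtain ⟨δ4, p4, q4, s4⟩ := aux_delta (fun j : J => x1 j) δ3 p3
  obtain ⟨δ5, p5, q5, s5⟩ := aux_delta (fun j : J => x2 j) δ4 p4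
  obtain ⟨δ6, p6, q6, s6⟩ := aux_delta (fun j : J => ((∑ j, (a1 j : ℝ)) - r) -
    ((∑ h ∈ G2, ((b j h : ℝ) - y j h)) + (a1 j : ℝ) - x1 j)) δ5 p5
  obtain ⟨δ, p7, q7, s7⟩ := aux_delta (fun j : J => ((∑ j, (a2 j : ℝ)) - r) -
    ((∑ h ∈ G1, ((b j h : ℝ) - y j h)) + (a2 j : ℝ) - x2 j)) δ6 p6
  have hR : ∀ j, 0 ≤ ∑ h ∈ G1, D j h ∧ 0 ≤ ∑ h ∈ G2, D j h ∧
      ∑ h ∈ G1, D j h + ∑ h ∈ G2, D j h ≤ 1 := fun j =>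
    ⟨Finset.sum_nonneg fun i _ => D0 j i, Finset.sum_nonneg fun i _ => D0 j i, by
      rw [← hsplit]; exact Dr j⟩
  have key := hopt (fun j h => y j h - δ * D j h) (fun j => x1 j - if j = g then δ else 0)
    (fun j => x2 j - if j = k then δ else 0) (r - δ) (w - δ) ?_
  · linarith
  refine ⟨⟨?_, ?_, ?_, ?_, ?_, ?_, ?_, ?_, ?_, ?_, ?_⟩, by linarith, by linarith⟩
  · intro h hh
    have := hsat1 h hh
    simp only [Finset.sum_sub_distrib, ← Finset.mul_sum, Dc]
    constructor <;> linarith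
  · intro h hh
    have := hsat2 h hh
    simp only [Finset.sum_sub_distrib, ← Finset.mul_sum, Dc]
    constructor <;> linarith
  · intro j
    simp only [Finset.sum_sub_distrib, ← Finset.mul_sum]
    rcases (F3 j).eq_or_lt with h | h
    · rw [Dt j h]; linarith
    · have h1 := s2 j (by linarith)
      have h2 : 0 ≤ δ * ∑ h, D j h := mul_nonneg p7.le (Finset.sum_nonneg fun i _ => D0 j i)
      linarith
  · intro j h
    have h0 := D0 j h
    have h1 := D1 j h
    have h2 := F4 j h
    have h3 : 0 ≤ δ * D j h := mul_nonneg p7.le h0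
    dsimp only
    refine ⟨?_, by linarith⟩
    rcases h0.eq_or_lt with h4 | h4
    · rw [← h4]; linarith
    · have h5 := s1 (j, h) (Ds j h h4)
      simp only at h5
      have h6 : δ * D j h ≤ δ * 1 := mul_le_mul_of_nonneg_left h1 p7.le
      linarith
  · simp [Finset.sum_sub_distrib, F5]
  · simp [Finset.sum_sub_distrib, F6]
  · intro j
    have e1 : 0 ≤ (if j = g then δ else 0) := by split_ifs <;> linarith
    have e2 : 0 ≤ (if j = k then δ else 0) := by split_ifs <;> linarith
    dsimp only
    rcases (F7 j).eq_or_lt with h | h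
    · rcases hx j h with h1 | h1
      · rw [if_pos h1] at e1 ⊢; linarith
      · rw [if_pos h1] at e2 ⊢; linarith
    · have h1 := s3 j (by linarith)
      linarith
  · intro j
    have h1 := F8 j
    dsimp only
    split_ifs with h
    · have h2 := s4 j (by rw [h]; exact hg)
      constructor <;> linarith
    · constructor <;> linarith
  · intro j
    have h1 := F9 j
    dsimp only
    split_ifs with h
    · have h2 := s5 j (by rw [h]; exact hk)
      constructor <;> linarith
    · constructor <;> linarith
  · intro j
    obtain ⟨r1, r2, r3⟩ := hR j
    have h1 := F10 j
    simp only [Finset.sum_sub_distrib, ← Finset.mul_sum] at h1 ⊢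
    have h2 : δ * ∑ h ∈ G1, D j h ≤ δ * 1 := mul_le_mul_of_nonneg_left (by linarith) p7.le
    split_ifs with h
    · rcases hkc' with h3 | h3
      · rw [← h] at h3
        have h4 := s7 j (by linarith)
        simp only [Finset.sum_sub_distrib] at h4
        linarith
      · rw [← h] at h3
        rw [h3]; linarith
    · linarith
  · intro j
    obtain ⟨r1, r2, r3⟩ := hR j
    have h1 := F11 j
    simp only [Finset.sum_sub_distrib, ← Finset.mul_sum] at h1 ⊢
    have h2 : δ * ∑ h ∈ G2, D j h ≤ δ * 1 := mul_le_mul_of_nonneg_left (by linarith) p7.le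
    split_ifs with h
    · rcases hga' with h3 | h3
      · rw [← h] at h3
        have h4 := s6 j (by linarith)
        simp only [Finset.sum_sub_distrib] at h4
        linarith
      · rw [← h] at h3
        rw [h3]; linarith
    · linarith

/-- If a tight job has load `w` on the group, its `x` is an integer. -/
theorem aux_int {J M : Type*} [Fintype J]
    (G : Finset M) (b : J → M → ℕ) (a : J → ℕ) (y : J → M → ℝ) (x : J → ℝ) (r w : ℝ)
    (z : ℤ) (hz : w - r = z) (k : J)
    (ht : (∑ h ∈ G, ((b k h : ℝ) - y k h)) + (a k : ℝ) - x k = (∑ j, (a j : ℝ)) - r)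
    (hl : ∑ h ∈ G, y k h = w) : ∃ z : ℤ, x k = z := by
  refine ⟨∑ h ∈ G, (b k h : ℤ) + a k - ∑ j, (a j : ℤ) - z, ?_⟩
  rw [Finset.sum_sub_distrib, hl] at ht
  push_cast
  linarith

theorem aux_main {J M : Type*} [Fintype J] [Fintype M] [DecidableEq J] [DecidableEq M]
    (G1 G2 : Finset M) (hG1ne : G1.Nonempty)
    (hdisj : Disjoint G1 G2) (hcover : G1 ∪ G2 = Finset.univ)
    (b : J → M → ℕ) (a1 a2 : J → ℕ) (rstar wstar : ℝ)
    (y : J → M → ℝ) (x1 x2 : J → ℝ) (r w : ℝ)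
    (hfeas : FeasibleLP G1 G2 b a1 a2 rstar wstar y x1 x2 r w)
    (hopt : ∀ y' x1' x2' r' w',
      FeasibleLP G1 G2 b a1 a2 rstar wstar y' x1' x2' r' w' → r ≤ r')
    (ε : ℝ) (hε0 : 0 < ε) (hε1 : ε < 1) (hrε : r = (⌊rstar⌋ : ℝ) + ε)
    (hsat1 : ∀ h ∈ G1, ((∑ j, y j h) = w) ∧
      (w = (∑ j, (b j h : ℝ)) - ((∑ j, (a2 j : ℝ)) - r)))
    (hsat2 : ∀ h ∈ G2, ((∑ j, y j h) = w) ∧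
      (w = (∑ j, (b j h : ℝ)) - ((∑ j, (a1 j : ℝ)) - r)))
    (g : J) (hgB : ¬∃ z : ℤ, x1 g = (z : ℝ)) :
      ((∑ h ∈ G2, ((b g h : ℝ) - y g h)) + (a1 g : ℝ) - x1 g =
        (∑ j, (a1 j : ℝ)) - r) ∧
      ((∑ h ∈ G2, y g h) < w) := by
  have hpert := aux_perturb G1 G2 hdisj hcover b a1 a2 rstar wstar y x1 x2 r w hfeas hopt
    (by linarith)
  obtain ⟨⟨F1, F2, F3, F4, F5, F6, F7, F8, F9, F10, F11⟩, hwr, -⟩ := hfeas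
  have hsplit : ∀ f : M → ℝ, ∑ h, f h = ∑ h ∈ G1, f h + ∑ h ∈ G2, f h := by
    intro f
    rw [← hcover, Finset.sum_union hdisj]
  have hn1 : ∀ j, 0 ≤ ∑ h ∈ G1, y j h := fun j => Finset.sum_nonneg fun i _ => (F4 j i).1
  have hn2 : ∀ j, 0 ≤ ∑ h ∈ G2, y j h := fun j => Finset.sum_nonneg fun i _ => (F4 j i).1
  have hle : ∀ j, ∑ h ∈ G1, y j h + ∑ h ∈ G2, y j h ≤ w := fun j => by
    rw [← hsplit]; exact F3 j
  have hrint : ¬ ∃ z : ℤ, r = z := by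
    rintro ⟨z, hz⟩
    rw [hz] at hrε
    have h1 : (⌊rstar⌋ : ℝ) < z := by linarith
    have h2 : (z : ℝ) < ⌊rstar⌋ + 1 := by linarith
    have h1' : ⌊rstar⌋ < z := by exact_mod_cast h1
    have h2' : z < ⌊rstar⌋ + 1 := by exact_mod_cast h2
    omega
  have hw : 0 < w := by
    obtain ⟨h, hh⟩ := hG1ne
    have h0 : 0 ≤ w := by
      rw [← (hsat1 h hh).1]
      exact Finset.sum_nonneg fun j _ => (F4 j h).1
    refine lt_of_le_of_ne h0 fun h1 => hrint ⟨-⌈wstar - rstar⌉, ?_⟩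
    push_cast
    linarith
  have hpert := hpert hw hsat1 hsat2
  have hgpos : 0 < x1 g :=
    lt_of_le_of_ne (F8 g).1 fun h => hgB ⟨0, by rw [← h]; simp⟩
  -- a job with non-integral `x2` is usable
  have husable : ∀ k, (¬∃ z : ℤ, x2 k = z) → 0 < x2 k ∧
      ((∑ h ∈ G1, ((b k h : ℝ) - y k h)) + (a2 k : ℝ) - x2 k < (∑ j, (a2 j : ℝ)) - r ∨
      ∑ h ∈ G1, y k h < w) := by
    intro k hk
    refine ⟨lt_of_le_of_ne (F9 k).1 fun h => hk ⟨0, by rw [← h]; simp⟩, ?_⟩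
    rcases (F10 k).eq_or_lt with h | h
    · right
      refine lt_of_le_of_ne (by linarith [hn2 k, hle k]) fun h1 => hk ?_
      exact aux_int G1 b a2 y x2 r w _ hwr k h h1
    · exact Or.inl h
  have hexk : ∃ k, ¬∃ z : ℤ, x2 k = z := by
    by_contra hcon
    push Not at hcon
    choose z hz using hcon
    refine hrint ⟨∑ j, z j, ?_⟩
    rw [← F6]
    push_cast
    exact Finset.sum_congr rfl fun j _ => hz j
  have htight : (∑ h ∈ G2, ((b g h : ℝ) - y g h)) + (a1 g : ℝ) - x1 g =
        (∑ j, (a1 j : ℝ)) - r := by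
    by_contra hnt
    have hlt := lt_of_le_of_ne (F11 g) hnt
    by_cases hA : ∃ j, j ≠ g ∧ x1 j + x2 j = r
    · obtain ⟨j, hjg, hj⟩ := hA
      have three : ∀ (x : J → ℝ), (∀ i, 0 ≤ x i) → ∀ i, i ≠ g → i ≠ j →
          x g + x j + x i ≤ ∑ i, x i := by
        intro x hx i hig hij
        have h1 : ∑ l ∈ ({g, j, i} : Finset J), x l ≤ ∑ l, x l :=
          Finset.sum_le_sum_of_subset_of_nonneg (Finset.subset_univ _) fun l _ _ => hx l
        rw [Finset.sum_insert (by simp [hjg.symm, hig.symm]),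
          Finset.sum_insert (by simp [hij.symm]), Finset.sum_singleton] at h1
        linarith
      have two : ∀ (x : J → ℝ), (∀ i, 0 ≤ x i) → x g + x j ≤ ∑ i, x i := by
        intro x hx
        have h1 : ∑ l ∈ ({g, j} : Finset J), x l ≤ ∑ l, x l :=
          Finset.sum_le_sum_of_subset_of_nonneg (Finset.subset_univ _) fun l _ _ => hx l
        rw [Finset.sum_insert (by simp [hjg.symm]), Finset.sum_singleton] at h1
        linarith
      have t1 := two x1 fun i => (F8 i).1
      have t2 := two x2 fun i => (F9 i).1
      have honly : ∀ i, x1 i + x2 i = r → i = g ∨ i = j := by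
        intro i hi
        by_contra hcon
        push Not at hcon
        have h1 := three x1 (fun i => (F8 i).1) i hcon.1 hcon.2
        have h2 := three x2 (fun i => (F9 i).1) i hcon.1 hcon.2
        have h3 := (F9 g).1
        linarith
      have hj2 : 0 < x2 j := by linarith
      by_cases hjc : (∑ h ∈ G1, ((b j h : ℝ) - y j h)) + (a2 j : ℝ) - x2 j <
          (∑ j, (a2 j : ℝ)) - r ∨ ∑ h ∈ G1, y j h < w
      · exact hpert g j hgpos hj2 honly (Or.inl hlt) hjc
      · push Not at hjc
        have hw1 : ∑ h ∈ G1, y j h = w := le_antisymm (by linarith [hn2 j, hle j]) hjc.2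
        have hq : ∑ h ∈ G2, y j h = 0 := le_antisymm (by linarith [hle j]) (hn2 j)
        obtain ⟨z, hz⟩ := aux_int G1 b a2 y x2 r w _ hwr j (le_antisymm (F10 j) hjc.1) hw1
        have hj1 : 0 < x1 j := by
          refine lt_of_le_of_ne (F8 j).1 fun h => hrint ⟨z, ?_⟩
          linarith
        obtain ⟨k, hkj, hk, hkt⟩ : ∃ k, k ≠ j ∧ (¬∃ z : ℤ, x2 k = z) ∧
            (x1 g + x2 g = r → k = g) := by
          by_cases hgt : x1 g + x2 g = r
          · refine ⟨g, hjg.symm, ?_, fun _ => rfl⟩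
            rintro ⟨z', hz'⟩
            refine hrint ⟨z + z', ?_⟩
            push_cast
            linarith
          · obtain ⟨k, hk⟩ := hexk
            exact ⟨k, fun h => hk ⟨z, by rw [h]; exact hz⟩, hk, fun h => absurd h hgt⟩
        obtain ⟨hk0, hk1⟩ := husable k hk
        refine hpert j k hj1 hk0 ?_ (Or.inr hq) hk1
        intro i hi
        rcases honly i hi with h | h
        · right; rw [h] at hi; rw [h]; exact (hkt hi).symm
        · exact Or.inl h
    · push Not at hA
      obtain ⟨k, hk⟩ := hexk
      obtain ⟨hk0, hk1⟩ := husable k hk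
      refine hpert g k hgpos hk0 ?_ (Or.inl hlt) hk1
      intro j hj
      left
      by_contra hne
      exact hA j hne hj
  refine ⟨htight, lt_of_le_of_ne (by linarith [hn1 g, hle g]) fun h1 => hgB ?_⟩
  exact aux_int G2 b a1 y x1 r w _ hwr g htight h1

theorem aux_symm {J M : Type*} [Fintype J] [Fintype M]
    {G1 G2 : Finset M} {b : J → M → ℕ} {a1 a2 : J → ℕ} {rstar wstar : ℝ}
    {y : J → M → ℝ} {x1 x2 : J → ℝ} {r w : ℝ}
    (h : FeasibleLP G1 G2 b a1 a2 rstar wstar y x1 x2 r w) :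
    FeasibleLP G2 G1 b a2 a1 rstar wstar y x2 x1 r w := by
  obtain ⟨⟨F1, F2, F3, F4, F5, F6, F7, F8, F9, F10, F11⟩, hwr, h2⟩ := h
  exact ⟨⟨F2, F1, F3, F4, F6, F5, fun j => by rw [add_comm]; exact F7 j, F9, F8, F11, F10⟩,
    hwr, h2⟩

theorem a_and_c_tightness
    {J M : Type*} [Fintype J] [Fintype M] [DecidableEq J] [DecidableEq M]
    (G1 G2 : Finset M) (hG1ne : G1.Nonempty) (hG2ne : G2.Nonempty)
    (hdisj : Disjoint G1 G2) (hcover : G1 ∪ G2 = Finset.univ)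
    (b : J → M → ℕ) (a1 a2 : J → ℕ)
    (ystar : J → M → ℝ) (x1star x2star : J → ℝ) (rstar wstar : ℝ)
    (hstar : FeasibleS G1 G2 b a1 a2 ystar x1star x2star rstar wstar)
    (hstaropt : ∀ y' x1' x2' r' w', FeasibleS G1 G2 b a1 a2 y' x1' x2' r' w' →
      wstar - rstar ≤ w' - r')
    (y : J → M → ℝ) (x1 x2 : J → ℝ) (r w : ℝ)
    (hfeas : FeasibleLP G1 G2 b a1 a2 rstar wstar y x1 x2 r w)
    (hopt : ∀ y' x1' x2' r' w',
      FeasibleLP G1 G2 b a1 a2 rstar wstar y' x1' x2' r' w' → r ≤ r')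
    (ε : ℝ) (hε0 : 0 < ε) (hε1 : ε < 1) (hrε : r = (⌊rstar⌋ : ℝ) + ε)
    (hsat1 : ∀ h ∈ G1, ((∑ j, y j h) = w) ∧
      (w = (∑ j, (b j h : ℝ)) - ((∑ j, (a2 j : ℝ)) - r)))
    (hsat2 : ∀ h ∈ G2, ((∑ j, y j h) = w) ∧
      (w = (∑ j, (b j h : ℝ)) - ((∑ j, (a1 j : ℝ)) - r)))
    (B1 B2 : Finset J)
    (hB1 : ∀ j, j ∈ B1 ↔ ¬∃ z : ℤ, x1 j = (z : ℝ))
    (hB2 : ∀ j, j ∈ B2 ↔ ¬∃ z : ℤ, x2 j = (z : ℝ))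
    :
    (∀ g ∈ B1,
      ((∑ h ∈ G2, ((b g h : ℝ) - y g h)) + (a1 g : ℝ) - x1 g =
        (∑ j, (a1 j : ℝ)) - r) ∧
      ((∑ h ∈ G2, y g h) < w)) ∧
    (∀ k ∈ B2,
      ((∑ h ∈ G1, ((b k h : ℝ) - y k h)) + (a2 k : ℝ) - x2 k =
        (∑ j, (a2 j : ℝ)) - r) ∧
      ((∑ h ∈ G1, y k h) < w)) := by
  refine ⟨fun g hg => ?_, fun k hk => ?_⟩
  · exact aux_main G1 G2 hG1ne hdisj hcover b a1 a2 rstar wstar y x1 x2 r w hfeas hopt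
      ε hε0 hε1 hrε hsat1 hsat2 g ((hB1 g).1 hg)
  · exact aux_main G2 G1 hG2ne hdisj.symm (by rw [Finset.union_comm]; exact hcover)
      b a2 a1 rstar wstar y x2 x1 r w (aux_symm hfeas)
      (fun y' x1' x2' r' w' h => hopt y' x2' x1' r' w' (aux_symm h))
      ε hε0 hε1 hrε hsat2 hsat1 k ((hB2 k).1 hk)
end
end

section
/- Each crossing job is e-crossing: if j ∈ B1 ∩ B2, then x_{j1} > 0, x_{j2} > 0, B1 ∖ {j} ≠ ∅ and B2 ∖ {j} ≠ ∅. -/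
open Finset

noncomputable section

/-- A permutation in the support of a doubly stochastic matrix through a given positive entry. -/
lemma exists_perm_support {n : Type*} [Fintype n] [DecidableEq n] (A : Matrix n n ℝ)
    (hA : A ∈ doublyStochastic ℝ n) (p q : n) (hpq : 0 < A p q) :
    ∃ σ : Equiv.Perm n, σ p = q ∧ ∀ i, 0 < A i (σ i) := by
  obtain ⟨ω, h0, -, hs⟩ := exists_eq_sum_perm_of_mem_doublyStochastic hA
  have hent : ∀ i k, A i k = ∑ σ : Equiv.Perm n, ω σ * (if σ i = k then 1 else 0) := by
    intro i k
    rw [← hs, Matrix.sum_apply]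
    refine Finset.sum_congr rfl fun σ _ => ?_
    simp [Equiv.Perm.permMatrix, PEquiv.toMatrix_apply, Equiv.toPEquiv_apply, eq_comm]
  have hnn : ∀ i k, ∀ σ ∈ (Finset.univ : Finset (Equiv.Perm n)),
      0 ≤ ω σ * (if σ i = k then (1:ℝ) else 0) := by
    intro i k σ _
    exact mul_nonneg (h0 σ) (by split_ifs <;> norm_num)
  rw [hent] at hpq
  obtain ⟨σ, -, hσ⟩ := Finset.exists_lt_of_sum_lt (s := Finset.univ) (f := fun _ => (0:ℝ))
    (by simpa using hpq)
  have h1 : σ p = q := by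
    by_contra h
    simp [h] at hσ
  have h2 : 0 < ω σ := by simpa [h1] using hσ
  refine ⟨σ, h1, fun i => ?_⟩
  rw [hent]
  refine lt_of_lt_of_le ?_ (Finset.single_le_sum (hnn i (σ i)) (Finset.mem_univ σ))
  simpa using h2

/-- Dilation matrix. -/
def dil {J M : Type*} [Fintype M] [DecidableEq J] (y : J → M → ℝ) (w : ℝ) :
    Matrix (J ⊕ M) (J ⊕ M) ℝ
  | Sum.inl i, Sum.inl k => if i = k then (w - ∑ h, y i h) / w else 0
  | Sum.inl i, Sum.inr h => y i h / w
  | Sum.inr h, Sum.inl i => y i h / w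
  | Sum.inr _, Sum.inr _ => 0

lemma dil_mem {J M : Type*} [Fintype J] [Fintype M] [DecidableEq J] [DecidableEq M]
    (y : J → M → ℝ) (w : ℝ) (hw : 0 < w) (hy : ∀ j h, 0 ≤ y j h)
    (hcol : ∀ h, ∑ j, y j h = w) (hrow : ∀ j, ∑ h, y j h ≤ w) :
    dil y w ∈ doublyStochastic ℝ (J ⊕ M) := by
  rw [mem_doublyStochastic_iff_sum]
  refine ⟨?_, ?_, ?_⟩
  · rintro (i | h) (k | g)
    · simp only [dil]
      split_ifs
      · exact div_nonneg (by linarith [hrow i]) hw.le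
      · exact le_rfl
    · exact div_nonneg (hy _ _) hw.le
    · exact div_nonneg (hy _ _) hw.le
    · exact le_rfl
  · rintro (i | h)
    · simp only [Fintype.sum_sum_type, dil, Finset.sum_ite_eq, Finset.mem_univ, if_true,
        ← Finset.sum_div]
      field_simp; ring
    · simp only [Fintype.sum_sum_type, dil, ← Finset.sum_div, hcol]
      simp [hw.ne']
  · rintro (i | h)
    · simp only [Fintype.sum_sum_type, dil, Finset.sum_ite_eq', Finset.mem_univ, if_true,
        ← Finset.sum_div]
      field_simp; ring
    · simp only [Fintype.sum_sum_type, dil, ← Finset.sum_div, hcol]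
      simp [hw.ne']

lemma exists_matching {J M : Type*} [Fintype J] [Fintype M] [DecidableEq J] [DecidableEq M]
    (y : J → M → ℝ) (w : ℝ) (hw : 0 < w) (hy : ∀ j h, 0 ≤ y j h)
    (hcol : ∀ h, ∑ j, y j h = w) (hrow : ∀ j, ∑ h, y j h ≤ w) (p q : J ⊕ M)
    (hpq : 0 < dil y w p q) :
    ∃ (σ : Equiv.Perm (J ⊕ M)) (f : M → J), σ p = q ∧
      (∀ h l, f h = l ↔ σ (Sum.inl l) = Sum.inr h) ∧
      (∀ h, 0 < y (f h) h) ∧ (∀ l, ∑ h, y l h = w → ∃ h, f h = l) := by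
  obtain ⟨σ, h1, h2⟩ := exists_perm_support _ (dil_mem y w hw hy hcol hrow) p q hpq
  have hex : ∀ h : M, ∃ l : J, σ (Sum.inl l) = Sum.inr h := by
    intro h
    have h3 := h2 (σ.symm (Sum.inr h))
    rw [Equiv.apply_symm_apply] at h3
    rcases hs : σ.symm (Sum.inr h) with l | g
    · exact ⟨l, by rw [← hs, Equiv.apply_symm_apply]⟩
    · rw [hs] at h3
      simp [dil] at h3
  choose f hf using hex
  refine ⟨σ, f, h1, ?_, ?_, ?_⟩
  · intro h l
    constructor
    · rintro rfl; exact hf h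
    · intro hl
      have := σ.injective (hl.trans (hf h).symm)
      exact (Sum.inl.inj this).symm
  · intro h
    have h3 := h2 (Sum.inl (f h))
    rw [hf h] at h3
    simp only [dil] at h3
    by_contra hc
    exact absurd h3 (not_lt.mpr (div_nonpos_of_nonpos_of_nonneg (not_lt.mp hc) hw.le))
  · intro l hl
    have h3 := h2 (Sum.inl l)
    rcases hs : σ (Sum.inl l) with k | h
    · rw [hs] at h3
      simp [dil, hl] at h3
    · exact ⟨h, σ.injective.eq_iff.mp ((hf h).trans hs.symm) |> Sum.inl.inj⟩

lemma FeasibleS.swap {J M : Type*} [Fintype J] [Fintype M]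
    {G1 G2 : Finset M} {b : J → M → ℕ} {a1 a2 : J → ℕ}
    {y : J → M → ℝ} {x1 x2 : J → ℝ} {r w : ℝ}
    (H : FeasibleS G1 G2 b a1 a2 y x1 x2 r w) : FeasibleS G2 G1 b a2 a1 y x2 x1 r w := by
  obtain ⟨h1, h2, h3, h4, h5, h6, h7, h8, h9, h10, h11⟩ := H
  exact ⟨h2, h1, h3, h4, h6, h5, fun j => by linarith [h7 j], h9, h8, h11, h10⟩

lemma exists_delta {ι : Type*} [Fintype ι] (g : ι → ℝ) :
    ∃ δ : ℝ, 0 < δ ∧ ∀ i, 0 < g i → δ ≤ g i := by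
  classical
  have : ∀ s : Finset ι, ∃ δ : ℝ, 0 < δ ∧ ∀ i ∈ s, 0 < g i → δ ≤ g i := by
    intro s
    induction s using Finset.induction_on with
    | empty => exact ⟨1, one_pos, by simp⟩
    | insert a s _ ih =>
      obtain ⟨δ, h0, h1⟩ := ih
      by_cases ha : 0 < g a
      · refine ⟨min δ (g a), lt_min h0 ha, fun i hi hgi => ?_⟩
        rcases Finset.mem_insert.mp hi with rfl | hi
        · exact min_le_right _ _
        · exact (min_le_left _ _).trans (h1 i hi hgi)
      · refine ⟨δ, h0, fun i hi hgi => ?_⟩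
        rcases Finset.mem_insert.mp hi with rfl | hi
        · exact absurd hgi ha
        · exact h1 i hi hgi
  obtain ⟨δ, h0, h1⟩ := this Finset.univ
  exact ⟨δ, h0, fun i => h1 i (Finset.mem_univ i)⟩

/-- Number of machines of `G` matched with job `l`. -/
def cnt {J M : Type*} [DecidableEq J] (f : M → J) (G : Finset M) (l : J) : ℝ :=
  ∑ h ∈ G, if f h = l then (1:ℝ) else 0

lemma cnt_nonneg {J M : Type*} [DecidableEq J] (f : M → J) (G : Finset M) (l : J) :
    0 ≤ cnt f G l := Finset.sum_nonneg fun h _ => by split_ifs <;> norm_num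

lemma perturb {J M : Type*} [Fintype J] [Fintype M] [DecidableEq J] [DecidableEq M]
    (G1 G2 : Finset M) (hdisj : Disjoint G1 G2) (hcover : G1 ∪ G2 = Finset.univ)
    (b : J → M → ℕ) (a1 a2 : J → ℕ) (y : J → M → ℝ) (x1 x2 : J → ℝ) (r w : ℝ)
    (H : FeasibleS G1 G2 b a1 a2 y x1 x2 r w)
    (hsat1 : ∀ h ∈ G1, ((∑ j, y j h) = w) ∧
      (w = (∑ j, (b j h : ℝ)) - ((∑ j, (a2 j : ℝ)) - r)))
    (hsat2 : ∀ h ∈ G2, ((∑ j, y j h) = w) ∧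
      (w = (∑ j, (b j h : ℝ)) - ((∑ j, (a1 j : ℝ)) - r)))
    (f : M → J) (u v : J) (δ : ℝ) (hδ : 0 < δ)
    (hk : ∀ l, cnt f G1 l + cnt f G2 l ≤ 1)
    (hy : ∀ h, δ ≤ y (f h) h) (hx1 : δ ≤ x1 u) (hx2 : δ ≤ x2 v)
    (hc : ∀ l, cnt f G1 l + cnt f G2 l = 1 ∨ δ ≤ w - ∑ h, y l h)
    (hd : ∀ l, l = u ∨ l = v ∨ δ ≤ r - (x1 l + x2 l))
    (ha : ∀ l, cnt f G1 l + (if l = v then 1 else 0) ≤ 1 ∨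
      δ ≤ (∑ j', (a2 j' : ℝ)) - r - ((∑ h ∈ G1, ((b l h : ℝ) - y l h)) + (a2 l : ℝ) - x2 l))
    (hb : ∀ l, cnt f G2 l + (if l = u then 1 else 0) ≤ 1 ∨
      δ ≤ (∑ j', (a1 j' : ℝ)) - r - ((∑ h ∈ G2, ((b l h : ℝ) - y l h)) + (a1 l : ℝ) - x1 l)) :
    FeasibleS G1 G2 b a1 a2 (fun l h => y l h - δ * (if f h = l then 1 else 0))
      (fun l => x1 l - δ * (if l = u then 1 else 0))
      (fun l => x2 l - δ * (if l = v then 1 else 0)) (r - δ) (w - δ) := by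
  obtain ⟨h1, h2, h3, h4, h5, h6, h7, h8, h9, h10, h11⟩ := H
  have hcolsum : ∀ h, ∑ l, (y l h - δ * (if f h = l then 1 else 0)) = (∑ l, y l h) - δ := by
    intro h
    rw [Finset.sum_sub_distrib, ← Finset.mul_sum]; simp
  have hG : ∀ (G : Finset M) l, ∑ h ∈ G, ((b l h : ℝ) - (y l h - δ * (if f h = l then 1 else 0)))
      = (∑ h ∈ G, ((b l h : ℝ) - y l h)) + δ * cnt f G l := by
    intro G l
    rw [cnt, Finset.mul_sum, ← Finset.sum_add_distrib]
    exact Finset.sum_congr rfl fun h _ => by ring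
  have hrowsum : ∀ l, ∑ h, (y l h - δ * (if f h = l then 1 else 0))
      = (∑ h, y l h) - δ * (cnt f G1 l + cnt f G2 l) := by
    intro l
    rw [Finset.sum_sub_distrib, ← Finset.mul_sum, cnt, cnt, ← Finset.sum_union hdisj, hcover]
  have hind : ∀ l u : J, (0:ℝ) ≤ (if l = u then 1 else 0) ∧ (if l = u then (1:ℝ) else 0) ≤ 1 := by
    intro l u; split_ifs <;> norm_num
  refine ⟨?_, ?_, ?_, ?_, ?_, ?_, ?_, ?_, ?_, ?_, ?_⟩
  · intro h hh
    obtain ⟨s1, s2⟩ := hsat1 h hh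
    simp only [hcolsum]
    constructor <;> linarith
  · intro h hh
    obtain ⟨s1, s2⟩ := hsat2 h hh
    simp only [hcolsum]
    constructor <;> linarith
  · intro l
    simp only [hrowsum]
    rcases hc l with e | e
    · rw [e]; linarith [h3 l]
    · have := mul_nonneg hδ.le (add_nonneg (cnt_nonneg f G1 l) (cnt_nonneg f G2 l))
      linarith
  · intro l h
    have := h4 l h
    by_cases e : f h = l
    · have e2 := hy h
      rw [e] at e2
      simp only [e, if_true]
      constructor <;> linarith
    · simpa [e] using this
  · rw [Finset.sum_sub_distrib, ← Finset.mul_sum, h5]; simp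
  · rw [Finset.sum_sub_distrib, ← Finset.mul_sum, h6]; simp
  · intro l
    have e1 := mul_nonneg hδ.le (hind l u).1
    have e2 := mul_nonneg hδ.le (hind l v).1
    rcases hd l with e | e | e
    · simp only [e, if_true] at *
      linarith [h7 u]
    · simp only [e, if_true] at *
      linarith [h7 v]
    · simp only
      linarith
  · intro l
    have := h8 l
    by_cases e : l = u
    · subst e
      simp only [if_true]
      constructor <;> linarith
    · simpa [e] using this
  · intro l
    have := h9 l
    by_cases e : l = v
    · subst e
      simp only [if_true]
      constructor <;> linarith
    · simpa [e] using this
  · intro l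
    simp only [hG]
    rcases ha l with e | e
    · have := mul_le_mul_of_nonneg_left e hδ.le
      linarith [h10 l]
    · have e1 : cnt f G1 l ≤ 1 := by linarith [hk l, cnt_nonneg f G2 l]
      have e1 := mul_le_mul_of_nonneg_left e1 hδ.le
      have e2 := mul_le_mul_of_nonneg_left (hind l v).2 hδ.le
      linarith
  · intro l
    simp only [hG]
    rcases hb l with e | e
    · have := mul_le_mul_of_nonneg_left e hδ.le
      linarith [h11 l]
    · have e1 : cnt f G2 l ≤ 1 := by linarith [hk l, cnt_nonneg f G1 l]
      have e1 := mul_le_mul_of_nonneg_left e1 hδ.le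
      have e2 := mul_le_mul_of_nonneg_left (hind l u).2 hδ.le
      linarith

lemma cnt_univ {J M : Type*} [Fintype M] [DecidableEq J] [DecidableEq M] (f : M → J)
    (hf : Function.Injective f) (G1 G2 : Finset M) (hdisj : Disjoint G1 G2)
    (hcover : G1 ∪ G2 = Finset.univ) (l : J) :
    cnt f G1 l + cnt f G2 l ≤ 1 ∧ ((∃ h, f h = l) → cnt f G1 l + cnt f G2 l = 1) := by
  have e : cnt f G1 l + cnt f G2 l = ∑ h, if f h = l then (1:ℝ) else 0 := by
    rw [cnt, cnt, ← Finset.sum_union hdisj, hcover]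
  have e1 : (∃ h, f h = l) → cnt f G1 l + cnt f G2 l = 1 := by
    rintro ⟨h, rfl⟩
    rw [e]
    simp [hf.eq_iff]
  refine ⟨?_, e1⟩
  by_cases hh : ∃ h, f h = l
  · exact (e1 hh).le
  · push Not at hh
    rw [e]; simp [hh]

lemma cnt_zero {J M : Type*} [DecidableEq J] (f : M → J) (G : Finset M) (l : J)
    (h : ∀ g ∈ G, f g ≠ l) : cnt f G l = 0 :=
  Finset.sum_eq_zero fun g hg => by simp [h g hg]

lemma core {J M : Type*} [Fintype J] [Fintype M] [DecidableEq J] [DecidableEq M]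
    (G1 G2 : Finset M) (hdisj : Disjoint G1 G2) (hcover : G1 ∪ G2 = Finset.univ)
    (b : J → M → ℕ) (a1 a2 : J → ℕ) (y : J → M → ℝ) (x1 x2 : J → ℝ) (r w : ℝ)
    (H : FeasibleS G1 G2 b a1 a2 y x1 x2 r w)
    (hsat1 : ∀ h ∈ G1, ((∑ j, y j h) = w) ∧
      (w = (∑ j, (b j h : ℝ)) - ((∑ j, (a2 j : ℝ)) - r)))
    (hsat2 : ∀ h ∈ G2, ((∑ j, y j h) = w) ∧
      (w = (∑ j, (b j h : ℝ)) - ((∑ j, (a1 j : ℝ)) - r)))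
    (c : ℤ) (hwr : w - r = c) (R : ℝ) (hR : R < r) (hw : 0 < w)
    (hopt : ∀ y' x1' x2' r' w', FeasibleS G1 G2 b a1 a2 y' x1' x2' r' w' →
      w' - r' = c → R ≤ r' → r ≤ r')
    (j : J) (hx1 : ¬∃ z : ℤ, x1 j = (z : ℝ)) (hx2 : ¬∃ z : ℤ, x2 j = (z : ℝ))
    (hint : ∃ z : ℤ, r - x1 j = (z : ℝ)) : False := by
  have H' := H
  obtain ⟨h1, h2, h3, h4, h5, h6, h7, h8, h9, h10, h11⟩ := H
  obtain ⟨z, hz⟩ := hint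
  -- slacks
  set sa : J → ℝ := fun l => (∑ j', (a2 j' : ℝ)) - r -
    ((∑ h ∈ G1, ((b l h : ℝ) - y l h)) + (a2 l : ℝ) - x2 l) with hsa
  set sb : J → ℝ := fun l => (∑ j', (a1 j' : ℝ)) - r -
    ((∑ h ∈ G2, ((b l h : ℝ) - y l h)) + (a1 l : ℝ) - x1 l) with hsb
  have hsa0 : ∀ l, 0 ≤ sa l := fun l => by simp only [hsa]; linarith [h10 l]
  have hsb0 : ∀ l, 0 ≤ sb l := fun l => by simp only [hsb]; linarith [h11 l]
  have hYsum : ∑ h, y j h = (∑ h ∈ G1, y j h) + ∑ h ∈ G2, y j h := by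
    rw [← Finset.sum_union hdisj, hcover]
  have hsaj : sa j = (∑ j', (a2 j' : ℝ)) - r - (∑ h ∈ G1, (b j h : ℝ)) + (∑ h ∈ G1, y j h)
      - a2 j + x2 j := by
    simp only [hsa, Finset.sum_sub_distrib]; ring
  have hsbj : sb j = (∑ j', (a1 j' : ℝ)) - r - (∑ h ∈ G2, (b j h : ℝ)) + (∑ h ∈ G2, y j h)
      - a1 j + x1 j := by
    simp only [hsb, Finset.sum_sub_distrib]; ring
  have x1pos : 0 < x1 j := lt_of_le_of_ne (h8 j).1 fun e => hx1 ⟨0, by simp [← e]⟩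
  have x2pos : 0 < x2 j := lt_of_le_of_ne (h9 j).1 fun e => hx2 ⟨0, by simp [← e]⟩
  have hdj : 0 < r - (x1 j + x2 j) := by
    refine lt_of_le_of_ne (by linarith [h7 j]) fun e => hx2 ⟨z, by linarith⟩
  have hnotall : ¬ (sa j = 0 ∧ sb j = 0 ∧ ∑ h, y j h = w) := by
    rintro ⟨e1, e2, e3⟩
    refine hx2 ⟨c + z - (∑ j', (a1 j' : ℤ)) - (∑ j', (a2 j' : ℤ)) + (∑ h ∈ G1, (b j h : ℤ))
      + (∑ h ∈ G2, (b j h : ℤ)) + a1 j + a2 j - 2 * c, ?_⟩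
    push_cast
    linarith
  have hY1 : ¬ (sb j = 0 ∧ ∑ h ∈ G2, y j h = w) := by
    rintro ⟨e2, e3⟩
    refine hx1 ⟨ - (∑ j', (a1 j' : ℤ)) + (∑ h ∈ G2, (b j h : ℤ)) + a1 j - c, ?_⟩
    push_cast
    linarith
  have hY2 : ¬ (sa j = 0 ∧ ∑ h ∈ G1, y j h = w) := by
    rintro ⟨e2, e3⟩
    refine hx2 ⟨ - (∑ j', (a2 j' : ℤ)) + (∑ h ∈ G1, (b j h : ℤ)) + a2 j - c, ?_⟩
    push_cast
    linarith
  have hcol : ∀ h, ∑ l, y l h = w := by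
    intro h
    have : h ∈ G1 ∪ G2 := by rw [hcover]; exact Finset.mem_univ h
    rcases Finset.mem_union.mp this with e | e
    · exact (hsat1 h e).1
    · exact (hsat2 h e).1
  have hy0 : ∀ l h, 0 ≤ y l h := fun l h => (h4 l h).1
  -- a good matching
  have hmatch : ∃ f : M → J, Function.Injective f ∧ (∀ h, 0 < y (f h) h) ∧
      (∀ l, ∑ h, y l h = w → ∃ h, f h = l) ∧ (0 < sa j ∨ ∀ h ∈ G1, f h ≠ j) ∧
      (0 < sb j ∨ ∀ h ∈ G2, f h ≠ j) := by
    have hpos : ∀ G : Finset M, 0 < ∑ h ∈ G, y j h → ∃ g ∈ G, 0 < y j g := by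
      intro G hG
      by_contra hcon
      push Not at hcon
      exact absurd hG (not_lt.mpr (Finset.sum_nonpos hcon))
    have n1 : 0 ≤ ∑ h ∈ G1, y j h := Finset.sum_nonneg fun h _ => hy0 j h
    have n2 : 0 ≤ ∑ h ∈ G2, y j h := Finset.sum_nonneg fun h _ => hy0 j h
    have hcases : (∑ h, y j h < w) ∨ (0 < sa j ∧ ∃ g ∈ G1, 0 < y j g) ∨
        (0 < sb j ∧ ∃ g ∈ G2, 0 < y j g) := by
      rcases lt_or_eq_of_le (h3 j) with e | e
      · exact Or.inl e
      right
      rcases eq_or_lt_of_le (hsa0 j) with ea | ea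
      · rcases eq_or_lt_of_le (hsb0 j) with eb | eb
        · exact absurd ⟨ea.symm, eb.symm, e⟩ hnotall
        · refine Or.inr ⟨eb, hpos _ (lt_of_le_of_ne n2 fun e0 => hY2 ⟨ea.symm, by linarith⟩)⟩
      · rcases eq_or_lt_of_le n1 with e1 | e1
        · rcases eq_or_lt_of_le (hsb0 j) with eb | eb
          · exact absurd ⟨eb.symm, by linarith⟩ hY1
          · exact Or.inr ⟨eb, hpos _ (by linarith)⟩
        · exact Or.inl ⟨ea, hpos _ e1⟩
    have hinj : ∀ (σ : Equiv.Perm (J ⊕ M)) (f : M → J),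
        (∀ h l, f h = l ↔ σ (Sum.inl l) = Sum.inr h) → Function.Injective f := by
      intro σ f hf h h' e
      have e1 := (hf h (f h)).mp rfl
      have e2 := (hf h' (f h)).mp e.symm
      exact Sum.inr.inj (e1.symm.trans e2)
    rcases hcases with e | ⟨es, g, hg, hyg⟩ | ⟨es, g, hg, hyg⟩
    · obtain ⟨σ, f, q1, q2, q3, q4⟩ := exists_matching y w hw hy0 hcol h3 (Sum.inl j) (Sum.inl j)
        (by simp only [dil, if_true]; exact div_pos (by linarith) hw)
      have : ∀ h, f h ≠ j := fun h hh => by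
        have := (q2 h j).mp hh
        rw [q1] at this
        cases this
      exact ⟨f, hinj σ f q2, q3, q4, Or.inr fun h _ => this h, Or.inr fun h _ => this h⟩
    · obtain ⟨σ, f, q1, q2, q3, q4⟩ := exists_matching y w hw hy0 hcol h3 (Sum.inl j) (Sum.inr g)
        (by simp only [dil]; exact div_pos hyg hw)
      refine ⟨f, hinj σ f q2, q3, q4, Or.inl es, Or.inr fun h hh e => ?_⟩
      have := Sum.inr.inj (((q2 h j).mp e).symm.trans q1)
      subst this
      exact Finset.disjoint_left.mp hdisj hg hh
    · obtain ⟨σ, f, q1, q2, q3, q4⟩ := exists_matching y w hw hy0 hcol h3 (Sum.inl j) (Sum.inr g)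
        (by simp only [dil]; exact div_pos hyg hw)
      refine ⟨f, hinj σ f q2, q3, q4, Or.inr fun h hh e => ?_, Or.inl es⟩
      have := Sum.inr.inj (((q2 h j).mp e).symm.trans q1)
      subst this
      exact Finset.disjoint_left.mp hdisj hh hg
  obtain ⟨f, hinj, hfy, hft, hfa, hfb⟩ := hmatch
  have hk := fun l => (cnt_univ f hinj G1 G2 hdisj hcover l).1
  have hk1 := fun l => (cnt_univ f hinj G1 G2 hdisj hcover l).2
  -- choice of the pair
  have hpair : ∃ u v : J, 0 < x1 u ∧ 0 < x2 v ∧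
      (∀ l, l = u ∨ l = v ∨ 0 < r - (x1 l + x2 l)) ∧
      (v = j ∨ ∀ h ∈ G1, f h ≠ v) ∧ (u = j ∨ ∀ h ∈ G2, f h ≠ u) := by
    by_cases hd : ∃ i, r - (x1 i + x2 i) ≤ 0
    · obtain ⟨i, hi⟩ := hd
      have hij : i ≠ j := by rintro rfl; linarith
      have two : ∀ x : J → ℝ, (∀ l, 0 ≤ x l) → ∑ l, x l = r → x i + x j ≤ r := by
        intro x hx hs
        rw [← hs, ← Finset.sum_pair hij]
        exact Finset.sum_le_sum_of_subset_of_nonneg (Finset.subset_univ _) fun l _ _ => hx l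
      have t1 := two x1 (fun l => (h8 l).1) h5
      have t2 := two x2 (fun l => (h9 l).1) h6
      have uniq : ∀ l, l = i ∨ 0 < r - (x1 l + x2 l) := by
        intro l
        by_contra hcon
        push Not at hcon
        obtain ⟨c1, c2⟩ := hcon
        have hlj : l ≠ j := by rintro rfl; linarith
        have three : ∀ x : J → ℝ, (∀ l, 0 ≤ x l) → ∑ l, x l = r → x l + (x i + x j) ≤ r := by
          intro x hx hs
          rw [← hs, ← Finset.sum_pair hij, ← Finset.sum_insert (by simp [c1, hlj])]
          exact Finset.sum_le_sum_of_subset_of_nonneg (Finset.subset_univ _) fun l _ _ => hx l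
        have t1 := three x1 (fun l => (h8 l).1) h5
        have t2 := three x2 (fun l => (h9 l).1) h6
        linarith
      by_cases hg : ∀ h ∈ G1, f h ≠ i
      · exact ⟨j, i, x1pos, by linarith, fun l => Or.inr (uniq l), Or.inr hg, Or.inl rfl⟩
      · push Not at hg
        obtain ⟨g, hg, hgi⟩ := hg
        refine ⟨i, j, by linarith, x2pos, fun l => (uniq l).imp_right Or.inr, Or.inl rfl,
          Or.inr fun h hh e => ?_⟩
        have := hinj (e.trans hgi.symm)
        subst this
        exact Finset.disjoint_left.mp hdisj hg hh
    · push Not at hd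
      exact ⟨j, j, x1pos, x2pos, fun l => Or.inr (Or.inr (hd l)), Or.inl rfl, Or.inl rfl⟩
  obtain ⟨u, v, hu, hv, huv, hva, hub⟩ := hpair
  obtain ⟨δ1, p1, d1⟩ := exists_delta sa
  obtain ⟨δ2, p2, d2⟩ := exists_delta sb
  obtain ⟨δ3, p3, d3⟩ := exists_delta (fun l => w - ∑ h, y l h)
  obtain ⟨δ4, p4, d4⟩ := exists_delta (fun l => r - (x1 l + x2 l))
  obtain ⟨δ5, p5, d5⟩ := exists_delta (fun h => y (f h) h)
  obtain ⟨δ, hδ, e1, e2, e3, e4, e5, e6, e7, e8⟩ : ∃ δ : ℝ, 0 < δ ∧ δ ≤ δ1 ∧ δ ≤ δ2 ∧ δ ≤ δ3 ∧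
      δ ≤ δ4 ∧ δ ≤ δ5 ∧ δ ≤ x1 u ∧ δ ≤ x2 v ∧ δ ≤ r - R := by
    obtain ⟨δ, hδ, hh⟩ := exists_delta ![δ1, δ2, δ3, δ4, δ5, x1 u, x2 v, r - R]
    exact ⟨δ, hδ, hh 0 p1, hh 1 p2, hh 2 p3, hh 3 p4, hh 4 p5, hh 5 hu, hh 6 hv,
      hh 7 (sub_pos.mpr hR)⟩
  have hfeas := perturb G1 G2 hdisj hcover b a1 a2 y x1 x2 r w H' hsat1 hsat2 f u v δ hδ hk
    (fun h => e5.trans (d5 h (hfy h))) e6 e7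
    (fun l => by
      rcases lt_or_eq_of_le (h3 l) with e | e
      · exact Or.inr (e3.trans (d3 l (by simpa using e)))
      · exact Or.inl (hk1 l (hft l e)))
    (fun l => (huv l).imp_right (Or.imp_right fun e => e4.trans (d4 l e)))
    (fun l => by
      by_cases hl : l = v
      · subst hl
        have : 0 < sa l ∨ ∀ h ∈ G1, f h ≠ l := by
          rcases hva with rfl | e
          · exact hfa
          · exact Or.inr e
        rcases this with e | e
        · exact Or.inr (e1.trans (d1 l e))
        · left; rw [cnt_zero f G1 l e]; simp
      · left
        simp only [hl, if_false]
        linarith [hk l, cnt_nonneg f G2 l])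
    (fun l => by
      by_cases hl : l = u
      · subst hl
        have : 0 < sb l ∨ ∀ h ∈ G2, f h ≠ l := by
          rcases hub with rfl | e
          · exact hfb
          · exact Or.inr e
        rcases this with e | e
        · exact Or.inr (e2.trans (d2 l e))
        · left; rw [cnt_zero f G2 l e]; simp
      · left
        simp only [hl, if_false]
        linarith [hk l, cnt_nonneg f G1 l])
  have := hopt _ _ _ _ _ hfeas (by linarith) (by linarith)
  linarith

lemma sub_int {J : Type*} [Fintype J] [DecidableEq J] (x : J → ℝ) (r : ℝ) (hs : ∑ l, x l = r)
    (j : J) (h : ∀ l, l ≠ j → ∃ z : ℤ, x l = z) : ∃ z : ℤ, r - x j = z := by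
  choose! g hg using h
  refine ⟨∑ l ∈ Finset.univ.erase j, g l, ?_⟩
  rw [← hs, ← Finset.add_sum_erase _ _ (Finset.mem_univ j)]
  push_cast
  rw [add_sub_cancel_left]
  exact Finset.sum_congr rfl fun l hl => hg l (Finset.ne_of_mem_erase hl)

theorem crossing_is_e_crossing
    {J M : Type*} [Fintype J] [Fintype M] [DecidableEq J] [DecidableEq M]
    (G1 G2 : Finset M) (hG1ne : G1.Nonempty) (hG2ne : G2.Nonempty)
    (hdisj : Disjoint G1 G2) (hcover : G1 ∪ G2 = Finset.univ)
    (b : J → M → ℕ) (a1 a2 : J → ℕ)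
    (ystar : J → M → ℝ) (x1star x2star : J → ℝ) (rstar wstar : ℝ)
    (hstar : FeasibleS G1 G2 b a1 a2 ystar x1star x2star rstar wstar)
    (hstaropt : ∀ y' x1' x2' r' w', FeasibleS G1 G2 b a1 a2 y' x1' x2' r' w' →
      wstar - rstar ≤ w' - r')
    (y : J → M → ℝ) (x1 x2 : J → ℝ) (r w : ℝ)
    (hfeas : FeasibleLP G1 G2 b a1 a2 rstar wstar y x1 x2 r w)
    (hopt : ∀ y' x1' x2' r' w',
      FeasibleLP G1 G2 b a1 a2 rstar wstar y' x1' x2' r' w' → r ≤ r')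
    (ε : ℝ) (hε0 : 0 < ε) (hε1 : ε < 1) (hrε : r = (⌊rstar⌋ : ℝ) + ε)
    (hsat1 : ∀ h ∈ G1, ((∑ j, y j h) = w) ∧
      (w = (∑ j, (b j h : ℝ)) - ((∑ j, (a2 j : ℝ)) - r)))
    (hsat2 : ∀ h ∈ G2, ((∑ j, y j h) = w) ∧
      (w = (∑ j, (b j h : ℝ)) - ((∑ j, (a1 j : ℝ)) - r)))
    (B1 B2 : Finset J)
    (hB1 : ∀ j, j ∈ B1 ↔ ¬∃ z : ℤ, x1 j = (z : ℝ))
    (hB2 : ∀ j, j ∈ B2 ↔ ¬∃ z : ℤ, x2 j = (z : ℝ))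
    :
    ∀ j ∈ B1 ∩ B2, 0 < x1 j ∧ 0 < x2 j ∧
      (B1 \ {j}).Nonempty ∧ (B2 \ {j}).Nonempty := by
  intro j hj
  obtain ⟨hj1, hj2⟩ := Finset.mem_inter.mp hj
  have n1 := (hB1 j).mp hj1
  have n2 := (hB2 j).mp hj2
  obtain ⟨H, hwr, hRr⟩ := hfeas
  obtain ⟨h1, h2, h3, h4, h5, h6, h7, h8, h9, h10, h11⟩ := id H
  have hw0 : 0 ≤ w := (Finset.sum_nonneg fun h _ => (h4 j h).1).trans (h3 j)
  have hw : 0 < w := by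
    refine lt_of_le_of_ne hw0 fun e => ?_
    have e1 : ε = ((-⌈wstar - rstar⌉ - ⌊rstar⌋ : ℤ) : ℝ) := by
      push_cast
      linarith
    rw [e1] at hε0 hε1
    have a : (0 : ℤ) < -⌈wstar - rstar⌉ - ⌊rstar⌋ := by exact_mod_cast hε0
    have b : (-⌈wstar - rstar⌉ - ⌊rstar⌋ : ℤ) < 1 := by exact_mod_cast hε1
    omega
  have hR : (⌊rstar⌋ : ℝ) < r := by linarith
  refine ⟨lt_of_le_of_ne (h8 j).1 fun e => n1 ⟨0, by simp [← e]⟩,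
    lt_of_le_of_ne (h9 j).1 fun e => n2 ⟨0, by simp [← e]⟩, ?_, ?_⟩
  · by_contra hne
    rw [Finset.not_nonempty_iff_eq_empty, Finset.sdiff_eq_empty_iff_subset] at hne
    refine core G1 G2 hdisj hcover b a1 a2 y x1 x2 r w H hsat1 hsat2 _ hwr _ hR hw
      (fun y' x1' x2' r' w' F e1 e2 => hopt y' x1' x2' r' w' ⟨F, e1, e2⟩) j n1 n2
      (sub_int x1 r h5 j fun l hl => ?_)
    by_contra hcon
    exact hl (Finset.mem_singleton.mp (hne ((hB1 l).mpr hcon)))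
  · by_contra hne
    rw [Finset.not_nonempty_iff_eq_empty, Finset.sdiff_eq_empty_iff_subset] at hne
    refine core G2 G1 hdisj.symm (by rw [Finset.union_comm]; exact hcover) b a2 a1 y x2 x1 r w
      H.swap hsat2 hsat1 _ hwr _ hR hw
      (fun y' x1' x2' r' w' F e1 e2 => hopt y' x2' x1' r' w' ⟨F.swap, e1, e2⟩) j n2 n1
      (sub_int x2 r h6 j fun l hl => ?_)
    by_contra hcon
    exact hl (Finset.mem_singleton.mp (hne ((hB2 l).mpr hcon)))
end
end

section
/- For each e-crossing job a we have x_{a1} + x_{a2} < r. -/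
open Finset

noncomputable section

/-- Small steps preserve a slack or non-binding inequality. -/
lemma small_step {f g : ℝ} (hf : 0 ≤ f) (h : 0 < f ∨ g ≤ 0) :
    ∀ᶠ δ in nhdsWithin (0 : ℝ) (Set.Ioi 0), δ * g ≤ f := by
  rcases h with h | h
  · have hc : Filter.Tendsto (fun δ : ℝ => δ * g) (nhdsWithin (0 : ℝ) (Set.Ioi 0)) (nhds 0) := by
      have : Continuous (fun δ : ℝ => δ * g) := by fun_prop
      have h2 := this.tendsto 0
      simp only [zero_mul] at h2
      exact h2.mono_left nhdsWithin_le_nhds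
    exact (hc.eventually (gt_mem_nhds h)).mono fun δ hδ => hδ.le
  · filter_upwards [self_mem_nhdsWithin] with δ hδ
    have : 0 < δ := hδ
    nlinarith

/-- A matching in the support of `y` covering all machines and all tight jobs. -/
lemma exists_matching_s13 {J M : Type*} [Fintype J] [Fintype M] [DecidableEq J] [DecidableEq M]
    (y : J → M → ℝ) (w : ℝ) (hw : 0 < w) (hy : ∀ j h, 0 ≤ y j h)
    (hcol : ∀ h, ∑ j, y j h = w) (hrow : ∀ j, ∑ h, y j h ≤ w)
    (k : J) (A : Finset M) (hk : ∑ h ∈ A, y k h < w) :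
    ∃ Q : J → M → ℝ, (∀ j h, 0 ≤ Q j h) ∧ (∀ j h, 0 < y j h ∨ Q j h ≤ 0) ∧
      (∀ h, ∑ j, Q j h = 1) ∧ (∀ j, ∑ h, Q j h ≤ 1) ∧
      (∀ j, (∑ h, y j h < w) ∨ 1 ≤ ∑ h, Q j h) ∧
      (∀ j, ∀ S : Finset M, ∑ h ∈ S, Q j h = 0 ∨ ∑ h ∈ S, Q j h = 1) ∧
      ∑ h ∈ A, Q k h = 0 := by
  classical
  let N : Matrix (J ⊕ M) (J ⊕ M) ℝ := fun p q =>
    match p, q with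
    | .inl j, .inl j' => if j = j' then 1 - (∑ h, y j h) / w else 0
    | .inl j, .inr h => y j h / w
    | .inr h, .inl j => y j h / w
    | .inr _, .inr _ => 0
  have hdiag : ∀ j, 0 ≤ 1 - (∑ h, y j h) / w := fun j => by
    have := (div_le_one hw).2 (hrow j)
    linarith
  have hN0 : ∀ p q, 0 ≤ N p q := by
    rintro (j | h) (j' | h')
    · by_cases e : j = j'
      · simpa [N, e] using (hrow j').trans' le_rfl |> fun t => (div_le_one hw).2 t
      · simp [N, e]
    · exact div_nonneg (hy _ _) hw.le
    · exact div_nonneg (hy _ _) hw.le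
    · exact le_rfl
  have hNr : ∀ p, ∑ q, N p q = 1 := by
    rintro (j | h)
    · simp [N, ← Finset.sum_div]
    · simp [N, ← Finset.sum_div, hcol, hw.ne']
  have hNc : ∀ q, ∑ p, N p q = 1 := by
    rintro (j | h)
    · simp [N, ← Finset.sum_div]
    · simp [N, ← Finset.sum_div, hcol, hw.ne']
  have hmem : N ∈ doublyStochastic ℝ (J ⊕ M) :=
    mem_doublyStochastic_iff_sum.2 ⟨hN0, hNr, hNc⟩
  obtain ⟨wt, hwt0, hwt1, hwtN⟩ := exists_eq_sum_perm_of_mem_doublyStochastic hmem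
  have hentry : ∀ p q, N p q = ∑ σ : Equiv.Perm (J ⊕ M), wt σ * (if σ p = q then 1 else 0) := by
    intro p q
    rw [← hwtN]
    simp [Matrix.sum_apply, Equiv.Perm.permMatrix, PEquiv.toMatrix_apply, eq_comm]
  -- a positive entry outside A
  obtain ⟨c, hcA, hc⟩ : ∃ c : J ⊕ M, (∀ h ∈ A, c ≠ .inr h) ∧ 0 < N (.inl k) c := by
    by_contra hcon
    push Not at hcon
    have h1 := hNr (.inl k)
    rw [Fintype.sum_sum_type] at h1
    have h2 : ∑ j, N (.inl k) (.inl j) ≤ 0 :=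
      Finset.sum_nonpos fun j _ => hcon (Sum.inl j) (by simp)
    have h3 : ∑ h, N (.inl k) (.inr h) ≤ ∑ h ∈ A, N (.inl k) (.inr h) := by
      rw [← Finset.sum_add_sum_compl A]
      have : ∑ h ∈ Aᶜ, N (.inl k) (.inr h) ≤ 0 :=
        Finset.sum_nonpos fun h hh => hcon (Sum.inr h) (by
          intro h' hh' e
          simp only [Sum.inr.injEq] at e
          subst e
          exact (Finset.mem_compl.1 hh) hh')
      linarith
    have h4 : ∑ h ∈ A, N (.inl k) (.inr h) = (∑ h ∈ A, y k h) / w := by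
      simp [N, Finset.sum_div]
    have h5 : (∑ h ∈ A, y k h) / w < 1 := (div_lt_one hw).2 hk
    linarith
  obtain ⟨σ, hσk, hσw⟩ : ∃ σ : Equiv.Perm (J ⊕ M), σ (.inl k) = c ∧ 0 < wt σ := by
    by_contra hcon
    push Not at hcon
    rw [hentry] at hc
    refine absurd hc (not_lt.2 (Finset.sum_nonpos fun σ _ => ?_))
    by_cases e : σ (.inl k) = c
    · simpa [e] using hcon σ e
    · simp [e]
  have hsupp : ∀ p, 0 < N p (σ p) := by
    intro p
    rw [hentry]
    refine Finset.sum_pos' (fun τ _ => ?_) ⟨σ, Finset.mem_univ _, by simpa using hσw⟩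
    exact mul_nonneg (hwt0 τ) (by split_ifs <;> norm_num)
  have hS : ∀ j, ∀ S : Finset M,
      (∑ h ∈ S, (if σ (.inl j) = .inr h then (1 : ℝ) else 0)) =
        if ∃ h ∈ S, σ (.inl j) = .inr h then 1 else 0 := by
    intro j S
    cases hs : σ (.inl j) with
    | inl j' => simp
    | inr h' => simp
  refine ⟨fun j h => if σ (.inl j) = .inr h then 1 else 0, ?_, ?_, ?_, ?_, ?_, ?_, ?_⟩
  · intro j h
    dsimp only
    split_ifs <;> norm_num
  · intro j h
    by_cases e : σ (.inl j) = .inr h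
    · left
      have := hsupp (.inl j)
      rw [e] at this
      exact (div_pos_iff_of_pos_right hw).1 this
    · right
      simp [e]
  · intro h
    cases hs : σ.symm (.inr h) with
    | inl j =>
      have e : ∀ j', σ (.inl j') = .inr h ↔ j' = j := by
        intro j'
        rw [← Equiv.eq_symm_apply, hs, Sum.inl.injEq]
      simp [e]
    | inr h' =>
      have e : σ (.inr h') = .inr h := by rw [← hs]; simp
      have := hsupp (.inr h')
      rw [e] at this
      exact absurd this (lt_irrefl _)
  · intro j
    rw [hS]
    split_ifs <;> norm_num
  · intro j
    rw [hS]
    cases hs : σ (.inl j) with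
    | inl j' =>
      left
      have := hsupp (.inl j)
      rw [hs] at this
      by_cases e : j = j'
      · have h2 : 0 < 1 - (∑ h, y j h) / w := by simpa [N, e] using this
        exact (div_lt_one hw).1 (by linarith)
      · simp [N, e] at this
    | inr h' => right; simp
  · intro j S
    rw [hS]
    split_ifs <;> simp
  · rw [hS, if_neg]
    rintro ⟨h, hh, e⟩
    exact hcA h hh (by rw [← hσk, e])

/-- If a decreasing direction exists, the solution is not optimal. -/
lemma no_direction {J M : Type*} [Fintype J] [Fintype M]
    (G1 G2 : Finset M) (hcover : ∀ h, h ∈ G1 ∨ h ∈ G2)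
    (b : J → M → ℕ) (a1 a2 : J → ℕ) (rstar wstar : ℝ)
    (y : J → M → ℝ) (x1 x2 : J → ℝ) (r w : ℝ)
    (hfeas : FeasibleLP G1 G2 b a1 a2 rstar wstar y x1 x2 r w)
    (hopt : ∀ y' x1' x2' r' w',
      FeasibleLP G1 G2 b a1 a2 rstar wstar y' x1' x2' r' w' → r ≤ r')
    (hr : (⌊rstar⌋ : ℝ) < r)
    (Q : J → M → ℝ) (X1 X2 : J → ℝ)
    (hQ0 : ∀ j h, 0 ≤ Q j h) (hQs : ∀ j h, 0 < y j h ∨ Q j h ≤ 0)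
    (hQc : ∀ h, ∑ j, Q j h = 1)
    (hQr : ∀ j, (∑ h, y j h < w) ∨ 1 ≤ ∑ h, Q j h)
    (hX10 : ∀ j, 0 ≤ X1 j) (hX20 : ∀ j, 0 ≤ X2 j)
    (hX1s : ∀ j, 0 < x1 j ∨ X1 j ≤ 0) (hX2s : ∀ j, 0 < x2 j ∨ X2 j ≤ 0)
    (hX1 : ∑ j, X1 j = 1) (hX2 : ∑ j, X2 j = 1)
    (hXr : ∀ j, x1 j + x2 j < r ∨ 1 ≤ X1 j + X2 j)
    (hA : ∀ j, (∑ h ∈ G1, ((b j h : ℝ) - y j h)) + (a2 j : ℝ) - x2 j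
        < (∑ j', (a2 j' : ℝ)) - r ∨ (∑ h ∈ G1, Q j h) + X2 j ≤ 1)
    (hD : ∀ j, (∑ h ∈ G2, ((b j h : ℝ) - y j h)) + (a1 j : ℝ) - x1 j
        < (∑ j', (a1 j' : ℝ)) - r ∨ (∑ h ∈ G2, Q j h) + X1 j ≤ 1) : False := by
  obtain ⟨⟨f1, f2, f3, f4, f5, f6, f7, f8, f9, f10, f11⟩, fw, fr⟩ := hfeas
  have e1 : ∀ᶠ δ in nhdsWithin (0 : ℝ) (Set.Ioi 0), ∀ j h, δ * Q j h ≤ y j h :=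
    Filter.eventually_all.2 fun j => Filter.eventually_all.2 fun h =>
      small_step (f4 j h).1 (hQs j h)
  have e2 : ∀ᶠ δ in nhdsWithin (0 : ℝ) (Set.Ioi 0), ∀ j, δ * X1 j ≤ x1 j :=
    Filter.eventually_all.2 fun j => small_step (f8 j).1 (hX1s j)
  have e3 : ∀ᶠ δ in nhdsWithin (0 : ℝ) (Set.Ioi 0), ∀ j, δ * X2 j ≤ x2 j :=
    Filter.eventually_all.2 fun j => small_step (f9 j).1 (hX2s j)
  have e4 : ∀ᶠ δ in nhdsWithin (0 : ℝ) (Set.Ioi 0), ∀ j,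
      δ * (1 - ∑ h, Q j h) ≤ w - ∑ h, y j h :=
    Filter.eventually_all.2 fun j => small_step (by linarith [f3 j])
      ((hQr j).imp (fun t => by linarith) (fun t => by linarith))
  have e5 : ∀ᶠ δ in nhdsWithin (0 : ℝ) (Set.Ioi 0), ∀ j,
      δ * (1 - (X1 j + X2 j)) ≤ r - (x1 j + x2 j) :=
    Filter.eventually_all.2 fun j => small_step (by linarith [f7 j])
      ((hXr j).imp (fun t => by linarith) (fun t => by linarith))
  have e6 : ∀ᶠ δ in nhdsWithin (0 : ℝ) (Set.Ioi 0), ∀ j,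
      δ * ((∑ h ∈ G1, Q j h) + X2 j - 1) ≤ (∑ j', (a2 j' : ℝ)) - r -
        ((∑ h ∈ G1, ((b j h : ℝ) - y j h)) + (a2 j : ℝ) - x2 j) :=
    Filter.eventually_all.2 fun j => small_step (by linarith [f10 j])
      ((hA j).imp (fun t => by linarith) (fun t => by linarith))
  have e7 : ∀ᶠ δ in nhdsWithin (0 : ℝ) (Set.Ioi 0), ∀ j,
      δ * ((∑ h ∈ G2, Q j h) + X1 j - 1) ≤ (∑ j', (a1 j' : ℝ)) - r -
        ((∑ h ∈ G2, ((b j h : ℝ) - y j h)) + (a1 j : ℝ) - x1 j) :=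
    Filter.eventually_all.2 fun j => small_step (by linarith [f11 j])
      ((hD j).imp (fun t => by linarith) (fun t => by linarith))
  have e8 : ∀ᶠ δ in nhdsWithin (0 : ℝ) (Set.Ioi 0), δ * 1 ≤ r - (⌊rstar⌋ : ℝ) :=
    small_step (by linarith) (Or.inl (by linarith))
  have e9 : ∀ᶠ δ in nhdsWithin (0 : ℝ) (Set.Ioi 0), 0 < δ := self_mem_nhdsWithin
  obtain ⟨δ, d1, d2, d3, d4, d5, d6, d7, d8, d9⟩ :=
    (e1.and (e2.and (e3.and (e4.and (e5.and (e6.and (e7.and (e8.and e9)))))))).exists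
  have hcol : ∀ h, ∑ j, (y j h - δ * Q j h) = (∑ j, y j h) - δ := fun h => by
    rw [Finset.sum_sub_distrib, ← Finset.mul_sum, hQc, mul_one]
  have key := hopt (fun j h => y j h - δ * Q j h) (fun j => x1 j - δ * X1 j)
    (fun j => x2 j - δ * X2 j) (r - δ) (w - δ) ⟨⟨?_, ?_, ?_, ?_, ?_, ?_, ?_, ?_, ?_, ?_, ?_⟩, ?_, ?_⟩
  · linarith
  · intro h hh
    rw [hcol]
    have := f1 h hh
    constructor <;> linarith
  · intro h hh
    rw [hcol]
    have := f2 h hh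
    constructor <;> linarith
  · intro j
    rw [Finset.sum_sub_distrib, ← Finset.mul_sum]
    linarith [d4 j]
  · intro j h
    have h1 := d1 j h
    have h2 := f4 j h
    have h3 := mul_nonneg d9.le (hQ0 j h)
    constructor <;> linarith
  · rw [Finset.sum_sub_distrib, ← Finset.mul_sum, hX1, f5, mul_one]
  · rw [Finset.sum_sub_distrib, ← Finset.mul_sum, hX2, f6, mul_one]
  · intro j
    linarith [d5 j]
  · intro j
    have h1 := d2 j
    have h2 := f8 j
    have h3 := mul_nonneg d9.le (hX10 j)
    constructor <;> linarith
  · intro j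
    have h1 := d3 j
    have h2 := f9 j
    have h3 := mul_nonneg d9.le (hX20 j)
    constructor <;> linarith
  · intro j
    have h1 := d6 j
    have h2 : ∑ h ∈ G1, ((b j h : ℝ) - (y j h - δ * Q j h)) =
        (∑ h ∈ G1, ((b j h : ℝ) - y j h)) + δ * ∑ h ∈ G1, Q j h := by
      rw [Finset.mul_sum, ← Finset.sum_add_distrib]
      exact Finset.sum_congr rfl fun h _ => by ring
    rw [h2]
    linarith
  · intro j
    have h1 := d7 j
    have h2 : ∑ h ∈ G2, ((b j h : ℝ) - (y j h - δ * Q j h)) =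
        (∑ h ∈ G2, ((b j h : ℝ) - y j h)) + δ * ∑ h ∈ G2, Q j h := by
      rw [Finset.mul_sum, ← Finset.sum_add_distrib]
      exact Finset.sum_congr rfl fun h _ => by ring
    rw [h2]
    linarith
  · linarith
  · linarith

/-- A job with fractional `x` whose group constraint is tight is not fully in that group. -/
lemma group_lt {J M : Type*} [Fintype J] (G : Finset M) (b : J → M → ℕ) (a : J → ℕ)
    (y : J → M → ℝ) (x : J → ℝ) (r w : ℝ) (c : ℤ) (hc : w - r = c) (k : J)
    (hk : ¬∃ z : ℤ, x k = (z : ℝ)) (hle : ∑ h ∈ G, y k h ≤ w)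
    (htight : (∑ h ∈ G, ((b k h : ℝ) - y k h)) + (a k : ℝ) - x k = (∑ j', (a j' : ℝ)) - r) :
    ∑ h ∈ G, y k h < w := by
  refine lt_of_le_of_ne hle fun e => hk ⟨(∑ h ∈ G, (b k h : ℤ)) + a k - (∑ j', (a j' : ℤ)) - c, ?_⟩
  rw [Finset.sum_sub_distrib, e] at htight
  push_cast
  linarith

/-- Matching adapted to a job `k` with fractional `x k`. -/
lemma exists_good {J M : Type*} [Fintype J] [Fintype M] [DecidableEq J] [DecidableEq M]
    (G : Finset M) (b : J → M → ℕ) (a : J → ℕ)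
    (y : J → M → ℝ) (x : J → ℝ) (r w : ℝ) (c : ℤ) (hc : w - r = c) (k : J)
    (hk : ¬∃ z : ℤ, x k = (z : ℝ))
    (hw : 0 < w) (hy : ∀ j h, 0 ≤ y j h)
    (hcol : ∀ h, ∑ j, y j h = w) (hrow : ∀ j, ∑ h, y j h ≤ w)
    (hG : (∑ h ∈ G, ((b k h : ℝ) - y k h)) + (a k : ℝ) - x k ≤ (∑ j', (a j' : ℝ)) - r) :
    ∃ Q : J → M → ℝ, (∀ j h, 0 ≤ Q j h) ∧ (∀ j h, 0 < y j h ∨ Q j h ≤ 0) ∧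
      (∀ h, ∑ j, Q j h = 1) ∧ (∀ j, ∑ h, Q j h ≤ 1) ∧
      (∀ j, (∑ h, y j h < w) ∨ 1 ≤ ∑ h, Q j h) ∧
      (∀ j, ∀ S : Finset M, ∑ h ∈ S, Q j h = 0 ∨ ∑ h ∈ S, Q j h = 1) ∧
      ((∑ h ∈ G, ((b k h : ℝ) - y k h)) + (a k : ℝ) - x k < (∑ j', (a j' : ℝ)) - r ∨
        ∑ h ∈ G, Q k h = 0) := by
  rcases hG.lt_or_eq with hlt | heq
  · obtain ⟨Q, q1, q2, q3, q4, q5, q6, _⟩ :=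
      exists_matching_s13 y w hw hy hcol hrow k ∅ (by simpa using hw)
    exact ⟨Q, q1, q2, q3, q4, q5, q6, Or.inl hlt⟩
  · have hle : ∑ h ∈ G, y k h ≤ w :=
      (Finset.sum_le_sum_of_subset_of_nonneg (Finset.subset_univ G)
        fun h _ _ => hy k h).trans (hrow k)
    obtain ⟨Q, q1, q2, q3, q4, q5, q6, q7⟩ :=
      exists_matching_s13 y w hw hy hcol hrow k G (group_lt G b a y x r w c hc k hk hle heq)
    exact ⟨Q, q1, q2, q3, q4, q5, q6, Or.inr q7⟩

theorem e_crossing_strict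
    {J M : Type*} [Fintype J] [Fintype M] [DecidableEq J] [DecidableEq M]
    (G1 G2 : Finset M) (hG1ne : G1.Nonempty) (hG2ne : G2.Nonempty)
    (hdisj : Disjoint G1 G2) (hcover : G1 ∪ G2 = Finset.univ)
    (b : J → M → ℕ) (a1 a2 : J → ℕ)
    (ystar : J → M → ℝ) (x1star x2star : J → ℝ) (rstar wstar : ℝ)
    (hstar : FeasibleS G1 G2 b a1 a2 ystar x1star x2star rstar wstar)
    (hstaropt : ∀ y' x1' x2' r' w', FeasibleS G1 G2 b a1 a2 y' x1' x2' r' w' →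
      wstar - rstar ≤ w' - r')
    (y : J → M → ℝ) (x1 x2 : J → ℝ) (r w : ℝ)
    (hfeas : FeasibleLP G1 G2 b a1 a2 rstar wstar y x1 x2 r w)
    (hopt : ∀ y' x1' x2' r' w',
      FeasibleLP G1 G2 b a1 a2 rstar wstar y' x1' x2' r' w' → r ≤ r')
    (ε : ℝ) (hε0 : 0 < ε) (hε1 : ε < 1) (hrε : r = (⌊rstar⌋ : ℝ) + ε)
    (hsat1 : ∀ h ∈ G1, ((∑ j, y j h) = w) ∧
      (w = (∑ j, (b j h : ℝ)) - ((∑ j, (a2 j : ℝ)) - r)))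
    (hsat2 : ∀ h ∈ G2, ((∑ j, y j h) = w) ∧
      (w = (∑ j, (b j h : ℝ)) - ((∑ j, (a1 j : ℝ)) - r)))
    (B1 B2 : Finset J)
    (hB1 : ∀ j, j ∈ B1 ↔ ¬∃ z : ℤ, x1 j = (z : ℝ))
    (hB2 : ∀ j, j ∈ B2 ↔ ¬∃ z : ℤ, x2 j = (z : ℝ))
    :
    ∀ ja ∈ B1 ∪ B2, 0 < x1 ja → 0 < x2 ja →
      (B1 \ {ja}).Nonempty → (B2 \ {ja}).Nonempty → x1 ja + x2 ja < r := by
  classical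
  intro ja _ hp1 hp2 ⟨i, hi⟩ ⟨k, hk⟩
  rw [Finset.mem_sdiff, Finset.mem_singleton] at hi hk
  obtain ⟨hiB, hia⟩ := hi
  obtain ⟨hkB, hka⟩ := hk
  rw [hB1] at hiB
  rw [hB2] at hkB
  have hfeas' := hfeas
  obtain ⟨⟨f1, f2, f3, f4, f5, f6, f7, f8, f9, f10, f11⟩, fw, fr⟩ := hfeas'
  by_contra hcon
  have htight : x1 ja + x2 ja = r := le_antisymm (f7 ja) (not_lt.1 hcon)
  have hcov : ∀ h, h ∈ G1 ∨ h ∈ G2 := fun h => by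
    rw [← Finset.mem_union, hcover]; exact Finset.mem_univ h
  have hcol : ∀ h, ∑ j, y j h = w := fun h =>
    (hcov h).elim (fun t => (hsat1 h t).1) (fun t => (hsat2 h t).1)
  have hy : ∀ j h, 0 ≤ y j h := fun j h => (f4 j h).1
  have hw : 0 < w := by
    obtain ⟨h, _⟩ := hG1ne
    have h0 : 0 ≤ w := by rw [← hcol h]; exact Finset.sum_nonneg fun j _ => hy j h
    refine lt_of_le_of_ne h0 fun e => ?_
    have h1 : ε = ((-⌈wstar - rstar⌉ - ⌊rstar⌋ : ℤ) : ℝ) := by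
      push_cast
      linarith
    rw [h1] at hε0 hε1
    have h2 : (0 : ℤ) < -⌈wstar - rstar⌉ - ⌊rstar⌋ := by exact_mod_cast hε0
    have h3 : -⌈wstar - rstar⌉ - ⌊rstar⌋ < (1 : ℤ) := by exact_mod_cast hε1
    omega
  have hrfl : (⌊rstar⌋ : ℝ) < r := by linarith
  have hi0 : 0 < x1 i := lt_of_le_of_ne (f8 i).1 fun e => hiB ⟨0, by simp [← e]⟩
  have hk0 : 0 < x2 k := lt_of_le_of_ne (f9 k).1 fun e => hkB ⟨0, by simp [← e]⟩
  -- a second tight job must carry all the remaining load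
  have hsecond : ∀ j l, j ≠ ja → l ≠ ja → l ≠ j → 0 < x1 l + x2 l → x1 j + x2 j < r := by
    intro j l hj hl hlj hpos
    have h1 : ∑ j, (x1 j + x2 j) = 2 * r := by
      rw [Finset.sum_add_distrib, f5, f6]; ring
    have h2 : ∑ t ∈ ({ja, j, l} : Finset J), (x1 t + x2 t) ≤ ∑ j, (x1 j + x2 j) :=
      Finset.sum_le_sum_of_subset_of_nonneg (Finset.subset_univ _)
        fun t _ _ => add_nonneg (f8 t).1 (f9 t).1
    rw [Finset.sum_insert (by simp [hj.symm, hl.symm]), Finset.sum_insert (by simp [hlj.symm]),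
      Finset.sum_singleton] at h2
    linarith
  obtain ⟨Q, q1, q2, q3, q4, q5, q6, q7⟩ :=
    exists_good G1 b a2 y x2 r w _ fw k hkB hw hy hcol f3 (f10 k)
  obtain ⟨P, p1, p2, p3, p4, p5, p6, p7⟩ :=
    exists_good G2 b a1 y x1 r w _ fw i hiB hw hy hcol f3 (f11 i)
  have hsplit : ∀ f : M → ℝ, ∑ h, f h = ∑ h ∈ G1, f h + ∑ h ∈ G2, f h := fun f => by
    rw [← hcover, Finset.sum_union hdisj]
  have qle : ∀ j, ∑ h ∈ G1, Q j h ≤ 1 ∧ ∑ h ∈ G2, Q j h ≤ 1 := fun j =>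
    ⟨by rcases q6 j G1 with e | e <;> linarith, by rcases q6 j G2 with e | e <;> linarith⟩
  have ple : ∀ j, ∑ h ∈ G1, P j h ≤ 1 ∧ ∑ h ∈ G2, P j h ≤ 1 := fun j =>
    ⟨by rcases p6 j G1 with e | e <;> linarith, by rcases p6 j G2 with e | e <;> linarith⟩
  have ind0 : ∀ l j : J, (0 : ℝ) ≤ if j = l then 1 else 0 := fun l j => by
    split_ifs <;> norm_num
  rcases q6 ja G2 with qa | qa
  · refine no_direction G1 G2 hcov b a1 a2 rstar wstar y x1 x2 r w hfeas hopt hrfl Q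
      (fun j => if j = ja then 1 else 0) (fun j => if j = k then 1 else 0)
      q1 q2 q3 q5 (ind0 ja) (ind0 k) ?_ ?_ (by simp) (by simp) ?_ ?_ ?_
    · intro j
      by_cases e : j = ja
      · left; rw [e]; exact hp1
      · right; simp [e]
    · intro j
      by_cases e : j = k
      · left; rw [e]; exact hk0
      · right; simp [e]
    · intro j
      by_cases e : j = ja
      · right; simpa [e] using ind0 k ja
      by_cases e' : j = k
      · right; simpa [e'] using ind0 ja k
      left
      exact hsecond j k e hka (Ne.symm e') (by linarith [(f8 k).1])
    · intro j
      by_cases e : j = k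
      · subst e
        exact q7.imp id fun t => by simp [t]
      · right; simpa [e] using (qle j).1
    · intro j
      right
      by_cases e : j = ja
      · subst e
        simp [qa]
      · simpa [e] using (qle j).2
  rcases p6 ja G1 with pa | pa
  · refine no_direction G1 G2 hcov b a1 a2 rstar wstar y x1 x2 r w hfeas hopt hrfl P
      (fun j => if j = i then 1 else 0) (fun j => if j = ja then 1 else 0)
      p1 p2 p3 p5 (ind0 i) (ind0 ja) ?_ ?_ (by simp) (by simp) ?_ ?_ ?_
    · intro j
      by_cases e : j = i
      · left; rw [e]; exact hi0
      · right; simp [e]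
    · intro j
      by_cases e : j = ja
      · left; rw [e]; exact hp2
      · right; simp [e]
    · intro j
      by_cases e : j = ja
      · right; simpa [e] using ind0 i ja
      by_cases e' : j = i
      · right; simpa [e'] using ind0 ja i
      left
      exact hsecond j i e hia (Ne.symm e') (by linarith [(f9 i).1])
    · intro j
      right
      by_cases e : j = ja
      · subst e
        simp [pa]
      · simpa [e] using (ple j).1
    · intro j
      by_cases e : j = i
      · subst e
        exact p7.imp id fun t => by simp [t]
      · right; simpa [e] using (ple j).2
  -- mixture of the two matchings
  have qa1 : ∑ h ∈ G1, Q ja h ≤ 0 := by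
    have := q4 ja
    rw [hsplit] at this
    linarith
  have pa2 : ∑ h ∈ G2, P ja h ≤ 0 := by
    have := p4 ja
    rw [hsplit] at this
    linarith
  have hmix : ∀ j, ∀ S : Finset M, ∑ h ∈ S, (Q j h + P j h) / 2 =
      (∑ h ∈ S, Q j h + ∑ h ∈ S, P j h) / 2 := fun j S => by
    rw [← Finset.sum_div, Finset.sum_add_distrib]
  refine no_direction G1 G2 hcov b a1 a2 rstar wstar y x1 x2 r w hfeas hopt hrfl
    (fun j h => (Q j h + P j h) / 2)
    (fun j => ((if j = ja then 1 else 0) + (if j = i then 1 else 0)) / 2)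
    (fun j => ((if j = ja then 1 else 0) + (if j = k then 1 else 0)) / 2)
    ?_ ?_ ?_ ?_ ?_ ?_ ?_ ?_ ?_ ?_ ?_ ?_ ?_
  · intro j h
    have := q1 j h
    have := p1 j h
    linarith
  · intro j h
    rcases q2 j h with t | t
    · exact Or.inl t
    rcases p2 j h with t' | t'
    · exact Or.inl t'
    right
    linarith
  · intro h
    rw [← Finset.sum_div, Finset.sum_add_distrib, q3, p3]
    norm_num
  · intro j
    rcases q5 j with t | t
    · exact Or.inl t
    rcases p5 j with t' | t'
    · exact Or.inl t'
    right
    rw [hmix]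
    linarith
  · intro j
    have := ind0 ja j
    have := ind0 i j
    linarith
  · intro j
    have := ind0 ja j
    have := ind0 k j
    linarith
  · intro j
    by_cases e : j = ja
    · left; rw [e]; exact hp1
    by_cases e' : j = i
    · left; rw [e']; exact hi0
    right; simp [e, e']
  · intro j
    by_cases e : j = ja
    · left; rw [e]; exact hp2
    by_cases e' : j = k
    · left; rw [e']; exact hk0
    right; simp [e, e']
  · rw [← Finset.sum_div, Finset.sum_add_distrib]
    norm_num
  · rw [← Finset.sum_div, Finset.sum_add_distrib]
    norm_num
  · intro j
    by_cases e : j = ja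
    · right
      have := ind0 i ja
      have := ind0 k ja
      subst e
      simp only [if_true]
      linarith
    by_cases e1 : j = i
    · by_cases e2 : j = k
      · right
        simp only [if_pos e1, if_pos e2, if_neg e]
        norm_num
      · left
        exact hsecond j k e hka (Ne.symm e2) (by linarith [(f8 k).1])
    · left
      exact hsecond j i e hia (Ne.symm e1) (by linarith [(f9 i).1])
  · intro j
    rw [hmix]
    by_cases e : j = ja
    · right
      subst e
      simp only [if_true, if_neg (Ne.symm hka)]
      linarith
    by_cases e' : j = k
    · subst e'
      refine q7.imp id fun t => ?_
      simp only [if_true, if_neg e]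
      have := (ple j).1
      linarith
    · right
      simp only [if_neg e, if_neg e']
      have := (ple j).1
      have := (qle j).1
      linarith
  · intro j
    rw [hmix]
    by_cases e : j = ja
    · right
      subst e
      simp only [if_true, if_neg (Ne.symm hia)]
      linarith
    by_cases e' : j = i
    · subst e'
      refine p7.imp id fun t => ?_
      simp only [if_true, if_neg e]
      have := (qle j).2
      linarith
    · right
      simp only [if_neg e, if_neg e']
      have := (ple j).2
      have := (qle j).2
      linarith
end
end

section
/- If x_{i1} + x_{i2} < r for each job i ∈ B1 ∪ B2, then no job is e-crossing. -/
open Finset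

noncomputable section

/-- Birkhoff: a matching in the support of `y`, covering all machines and all tight jobs,
which does not match `j0` into `G`. -/
theorem exists_good_matching {J M : Type*} [Fintype J] [Fintype M] [DecidableEq J]
    [DecidableEq M] (y : J → M → ℝ) (w : ℝ) (hw : 0 < w) (hy : ∀ j h, 0 ≤ y j h)
    (hcol : ∀ h, ∑ j, y j h = w) (hrow : ∀ j, ∑ h, y j h ≤ w) (j0 : J) (G : Finset M)
    (hlt : ∑ h ∈ G, y j0 h < w) :
    ∃ f : J → Option M, (∀ j h, f j = some h → 0 < y j h) ∧
      (∀ j, ∑ h, y j h = w → f j ≠ none) ∧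
      (∀ h, ∃ j, f j = some h ∧ ∀ j', f j' = some h → j' = j) ∧
      (∀ h ∈ G, f j0 ≠ some h) := by
  classical
  let N : Matrix (J ⊕ M) (J ⊕ M) ℝ := fun i k => match i, k with
    | Sum.inl j, Sum.inl j' => if j = j' then 1 - (∑ h, y j h) / w else 0
    | Sum.inl j, Sum.inr h => y j h / w
    | Sum.inr h, Sum.inl j => y j h / w
    | Sum.inr _, Sum.inr _ => 0
  have hsymm : ∀ i k, N i k = N k i := by
    rintro (j | h) (j' | h')
    · by_cases hjj : j = j'
      · subst hjj; rfl
      · simp [N, hjj, Ne.symm hjj]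
    · rfl
    · rfl
    · rfl
  have hrows : ∀ i, ∑ k, N i k = 1 := by
    rintro (j | h)
    · rw [Fintype.sum_sum_type]
      simp [N, ← Finset.sum_div]
    · rw [Fintype.sum_sum_type]
      simp [N, ← Finset.sum_div, hcol, hw.ne']
  have hN : N ∈ doublyStochastic ℝ (J ⊕ M) := by
    rw [mem_doublyStochastic_iff_sum]
    refine ⟨?_, hrows, fun k => ?_⟩
    · rintro (j | h) (j' | h')
      · by_cases hjj : j = j'
        · subst hjj
          have : (∑ h, y j h) / w ≤ 1 := by rw [div_le_one hw]; exact hrow j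
          simp [N, this]
        · simp [N, hjj]
      · exact div_nonneg (hy _ _) hw.le
      · exact div_nonneg (hy _ _) hw.le
      · exact le_refl _
    · rw [← hrows k]
      exact Finset.sum_congr rfl fun i _ => hsymm i k
  obtain ⟨c, hc0, hc1, hcN⟩ := exists_eq_sum_perm_of_mem_doublyStochastic hN
  have hent : ∀ i k, N i k = ∑ σ, c σ * (if σ i = k then 1 else 0) := by
    intro i k
    rw [← hcN, Matrix.sum_apply]
    refine Finset.sum_congr rfl fun σ _ => ?_
    simp [PEquiv.toMatrix_apply, Equiv.toPEquiv_apply]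
  have hpos : ∀ σ, 0 < c σ → ∀ i, 0 < N i (σ i) := by
    intro σ hσ i
    rw [hent]
    refine lt_of_lt_of_le (b := c σ * (if σ i = σ i then 1 else 0)) (by simpa using hσ) ?_
    exact Finset.single_le_sum (f := fun τ => c τ * (if τ i = σ i then (1:ℝ) else 0))
      (fun τ _ => mul_nonneg (hc0 τ) (by split_ifs <;> norm_num)) (Finset.mem_univ σ)
  have hex : ∃ σ, 0 < c σ ∧ ∀ h ∈ G, σ (Sum.inl j0) ≠ Sum.inr h := by
    by_contra hcon
    push Not at hcon
    have h1 : ∑ h ∈ G, N (Sum.inl j0) (Sum.inr h) < 1 := by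
      have : ∑ h ∈ G, N (Sum.inl j0) (Sum.inr h) = (∑ h ∈ G, y j0 h) / w := by
        simp [N, Finset.sum_div]
      rw [this, div_lt_one hw]; exact hlt
    have h2 : (1:ℝ) ≤ ∑ h ∈ G, N (Sum.inl j0) (Sum.inr h) := by
      simp_rw [hent]
      rw [Finset.sum_comm]
      refine hc1.symm.le.trans ?_
      refine Finset.sum_le_sum fun σ _ => ?_
      rcases (hc0 σ).lt_or_eq with hp | hp
      · obtain ⟨h, hG, hh⟩ := hcon σ hp
        refine le_trans (b := c σ * (if σ (Sum.inl j0) = Sum.inr h then 1 else 0)) (by simp [hh]) ?_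
        exact Finset.single_le_sum
          (f := fun h => c σ * (if σ (Sum.inl j0) = Sum.inr h then (1:ℝ) else 0))
          (fun τ _ => mul_nonneg (hc0 σ) (by split_ifs <;> norm_num)) hG
      · simp [← hp]
    linarith
  obtain ⟨σ, hσ, hσG⟩ := hex
  have hP := hpos σ hσ
  refine ⟨fun j => (σ (Sum.inl j)).getRight?, ?_, ?_, ?_, ?_⟩
  · intro j h hj
    rw [Sum.getRight?_eq_some_iff] at hj
    have := hP (Sum.inl j)
    rw [hj] at this
    have h3 : 0 < y j h / w := this
    exact (div_pos_iff_of_pos_right hw).1 h3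
  · intro j hj hn
    simp only [Sum.getRight?_eq_none_iff, Sum.isLeft_iff] at hn
    obtain ⟨j', hj'⟩ := hn
    have := hP (Sum.inl j)
    rw [hj'] at this
    have h3 : 0 < (if j = j' then 1 - (∑ h, y j h) / w else 0) := this
    rw [hj, div_self hw.ne'] at h3
    simp at h3
  · intro h
    rcases hk : σ.symm (Sum.inr h) with j | h'
    · have hj : σ (Sum.inl j) = Sum.inr h := by rw [← hk]; simp
      refine ⟨j, by simp [hj], fun j' hj' => ?_⟩
      rw [Sum.getRight?_eq_some_iff, ← hj] at hj'
      exact Sum.inl_injective (σ.injective hj')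
    · exfalso
      have hj : σ (Sum.inr h') = Sum.inr h := by rw [← hk]; simp
      have := hP (Sum.inr h')
      rw [hj] at this
      exact lt_irrefl _ (show (0:ℝ) < 0 from this)
  · intro h hG hh
    rw [Sum.getRight?_eq_some_iff] at hh
    exact hσG h hG hh

theorem eventually_le_of_pos (s : ℝ) (hs : 0 < s) :
    ∀ᶠ δ in nhdsWithin (0:ℝ) (Set.Ioi 0), δ ≤ s := by
  filter_upwards [Ioo_mem_nhdsGT hs] with δ hδ
  exact hδ.2.le

/-- A direction `(e, d1, d2)` of decrease of the tight constraints can be followed. -/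
theorem exists_decrease {J M : Type*} [Fintype J] [Fintype M] [DecidableEq J] [DecidableEq M]
    (G1 G2 : Finset M) (b : J → M → ℕ) (a1 a2 : J → ℕ)
    (y : J → M → ℝ) (x1 x2 : J → ℝ) (r w : ℝ)
    (hf : FeasibleS G1 G2 b a1 a2 y x1 x2 r w)
    (hx : ∀ j, x1 j + x2 j < r) (ε : ℝ) (hε : 0 < ε)
    (e : J → M → ℝ) (d1 d2 : J → ℝ)
    (he0 : ∀ j h, 0 ≤ e j h) (he1 : ∀ j h, e j h ≤ 1) (hey : ∀ j h, 0 < e j h → 0 < y j h)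
    (hec : ∀ h, ∑ j, e j h = 1) (her : ∀ j, ∑ h, e j h ≤ 1)
    (het : ∀ j, ∑ h, y j h = w → ∑ h, e j h = 1)
    (hd10 : ∀ j, 0 ≤ d1 j) (hd11 : ∀ j, d1 j ≤ 1) (hd1x : ∀ j, 0 < d1 j → 0 < x1 j)
    (hd20 : ∀ j, 0 ≤ d2 j) (hd21 : ∀ j, d2 j ≤ 1) (hd2x : ∀ j, 0 < d2 j → 0 < x2 j)
    (hd1s : ∑ j, d1 j = 1) (hd2s : ∑ j, d2 j = 1)
    (ht1 : ∀ j, (∑ h ∈ G1, ((b j h : ℝ) - y j h)) + (a2 j : ℝ) - x2 j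
      = (∑ j', (a2 j' : ℝ)) - r → ∑ h ∈ G1, e j h + d2 j ≤ 1)
    (ht2 : ∀ j, (∑ h ∈ G2, ((b j h : ℝ) - y j h)) + (a1 j : ℝ) - x1 j
      = (∑ j', (a1 j' : ℝ)) - r → ∑ h ∈ G2, e j h + d1 j ≤ 1) :
    ∃ δ : ℝ, 0 < δ ∧ δ ≤ ε ∧ FeasibleS G1 G2 b a1 a2 (fun j h => y j h - δ * e j h)
      (fun j => x1 j - δ * d1 j) (fun j => x2 j - δ * d2 j) (r - δ) (w - δ) := by
  obtain ⟨f1, f2, f3, f4, f5, f6, f7, f8, f9, f10, f11⟩ := hf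
  have ev : ∀ᶠ δ in nhdsWithin (0:ℝ) (Set.Ioi 0),
      δ ∈ Set.Ioi (0:ℝ) ∧ (0 < ε → δ ≤ ε) ∧
      (∀ j, (0 < w - ∑ h, y j h → δ ≤ w - ∑ h, y j h)) ∧
      (∀ j h, (0 < y j h → δ ≤ y j h)) ∧
      (∀ j, (0 < r - x1 j - x2 j → δ ≤ r - x1 j - x2 j)) ∧
      (∀ j, (0 < x1 j → δ ≤ x1 j)) ∧ (∀ j, (0 < x2 j → δ ≤ x2 j)) ∧
      (∀ j, (0 < (∑ j', (a2 j' : ℝ)) - r -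
          ((∑ h ∈ G1, ((b j h : ℝ) - y j h)) + (a2 j : ℝ) - x2 j) →
        δ ≤ (∑ j', (a2 j' : ℝ)) - r -
          ((∑ h ∈ G1, ((b j h : ℝ) - y j h)) + (a2 j : ℝ) - x2 j))) ∧
      (∀ j, (0 < (∑ j', (a1 j' : ℝ)) - r -
          ((∑ h ∈ G2, ((b j h : ℝ) - y j h)) + (a1 j : ℝ) - x1 j) →
        δ ≤ (∑ j', (a1 j' : ℝ)) - r -
          ((∑ h ∈ G2, ((b j h : ℝ) - y j h)) + (a1 j : ℝ) - x1 j))) := by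
    refine Filter.Eventually.and self_mem_nhdsWithin ?_
    simp only [Filter.eventually_and, Filter.eventually_all]
    refine ⟨eventually_le_of_pos _, fun _ => eventually_le_of_pos _,
      fun _ _ => eventually_le_of_pos _, fun _ => eventually_le_of_pos _,
      fun _ => eventually_le_of_pos _, fun _ => eventually_le_of_pos _,
      fun _ => eventually_le_of_pos _, fun _ => eventually_le_of_pos _⟩
  obtain ⟨δ, hδ0, g1, g2, g3, g4, g5, g6, g7, g8⟩ := ev.exists
  have hδ : 0 < δ := hδ0
  have hle : ∀ u : ℝ, u ≤ 1 → δ * u ≤ δ := fun u hu => by nlinarith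
  have hge : ∀ u : ℝ, 0 ≤ u → 0 ≤ δ * u := fun u hu => by positivity
  have hsub : ∀ (G : Finset M) j, ∑ h ∈ G, e j h ≤ 1 := fun G j =>
    (Finset.sum_le_sum_of_subset_of_nonneg (Finset.subset_univ G)
      (fun h _ _ => he0 j h)).trans (her j)
  have hsum : ∀ (G : Finset M) j, ∑ h ∈ G, ((b j h : ℝ) - (y j h - δ * e j h)) =
      ∑ h ∈ G, ((b j h : ℝ) - y j h) + δ * ∑ h ∈ G, e j h := by
    intro G j
    rw [Finset.mul_sum, ← Finset.sum_add_distrib]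
    exact Finset.sum_congr rfl fun h _ => by ring
  have hcl : ∀ h, ∑ j, (y j h - δ * e j h) = ∑ j, y j h - δ := by
    intro h
    rw [Finset.sum_sub_distrib, ← Finset.mul_sum, hec, mul_one]
  refine ⟨δ, hδ, g1 hε, ?_, ?_, ?_, ?_, ?_, ?_, ?_, ?_, ?_, ?_, ?_⟩
  · intro h hh
    have := f1 h hh
    rw [hcl]
    constructor <;> linarith
  · intro h hh
    have := f2 h hh
    rw [hcl]
    constructor <;> linarith
  · intro j
    rw [Finset.sum_sub_distrib, ← Finset.mul_sum]
    rcases (f3 j).lt_or_eq with hlt | heq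
    · have := g2 j (by linarith)
      have := hge _ (Finset.sum_nonneg fun h (_ : h ∈ Finset.univ) => he0 j h)
      linarith
    · rw [het j heq, heq]; linarith
  · intro j h
    refine ⟨?_, ?_⟩
    · rcases (he0 j h).lt_or_eq with hp | hp
      · have := g3 j h (hey j h hp)
        have := hle _ (he1 j h)
        linarith
      · beta_reduce; rw [← hp]; linarith [f4 j h]
    · linarith [hge _ (he0 j h), f4 j h]
  · rw [Finset.sum_sub_distrib, ← Finset.mul_sum, hd1s, f5, mul_one]
  · rw [Finset.sum_sub_distrib, ← Finset.mul_sum, hd2s, f6, mul_one]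
  · intro j
    have := g4 j (by linarith [hx j])
    linarith [hge _ (hd10 j), hge _ (hd20 j)]
  · intro j
    refine ⟨?_, ?_⟩
    · rcases (hd10 j).lt_or_eq with hp | hp
      · have := g5 j (hd1x j hp)
        have := hle _ (hd11 j)
        linarith
      · beta_reduce; rw [← hp]; linarith [f8 j]
    · linarith [hge _ (hd10 j), f8 j]
  · intro j
    refine ⟨?_, ?_⟩
    · rcases (hd20 j).lt_or_eq with hp | hp
      · have := g6 j (hd2x j hp)
        have := hle _ (hd21 j)
        linarith
      · beta_reduce; rw [← hp]; linarith [f9 j]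
    · linarith [hge _ (hd20 j), f9 j]
  · intro j
    rw [hsum]
    rcases (f10 j).lt_or_eq with hlt | heq
    · have := g7 j (by linarith)
      have := hle _ (hsub G1 j)
      have := hle _ (hd21 j)
      linarith
    · have := hle _ (ht1 j heq)
      linarith
  · intro j
    rw [hsum]
    rcases (f11 j).lt_or_eq with hlt | heq
    · have := g8 j (by linarith)
      have := hle _ (hsub G2 j)
      have := hle _ (hd11 j)
      linarith
    · have := hle _ (ht2 j heq)
      linarith

/-- Number of edges (0 or 1) at a job into `G`. -/
theorem sum_matching {M : Type*} [DecidableEq M] (G : Finset M) (o : Option M) :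
    (∑ h ∈ G, (if o = some h then (1:ℝ) else 0)) ≤ 1 ∧
    ((∀ h ∈ G, o ≠ some h) → (∑ h ∈ G, (if o = some h then (1:ℝ) else 0)) = 0) := by
  refine ⟨?_, fun hh => Finset.sum_eq_zero fun h hG => by simp [hh h hG]⟩
  cases o with
  | none => simp
  | some k => simp only [Option.some.injEq, Finset.sum_ite_eq]; split_ifs <;> norm_num

theorem exists_decrease_matching {J M : Type*} [Fintype J] [Fintype M] [DecidableEq J]
    [DecidableEq M]
    (G1 G2 : Finset M) (b : J → M → ℕ) (a1 a2 : J → ℕ)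
    (y : J → M → ℝ) (x1 x2 : J → ℝ) (r w : ℝ)
    (hf : FeasibleS G1 G2 b a1 a2 y x1 x2 r w)
    (hx : ∀ j, x1 j + x2 j < r) (ε : ℝ) (hε : 0 < ε)
    (f g : J → Option M)
    (hfy : ∀ j h, f j = some h → 0 < y j h) (hgy : ∀ j h, g j = some h → 0 < y j h)
    (hft : ∀ j, ∑ h, y j h = w → f j ≠ none) (hgt : ∀ j, ∑ h, y j h = w → g j ≠ none)
    (hfc : ∀ h, ∃ j, f j = some h ∧ ∀ j', f j' = some h → j' = j)
    (hgc : ∀ h, ∃ j, g j = some h ∧ ∀ j', g j' = some h → j' = j)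
    (p p' q q' : J) (hp : 0 < x1 p) (hp' : 0 < x1 p') (hq : 0 < x2 q) (hq' : 0 < x2 q')
    (ht1 : ∀ j, (∑ h ∈ G1, ((b j h : ℝ) - y j h)) + (a2 j : ℝ) - x2 j
      = (∑ j', (a2 j' : ℝ)) - r →
      ∑ h ∈ G1, (if f j = some h then (1:ℝ) else 0) + ∑ h ∈ G1, (if g j = some h then (1:ℝ) else 0)
        + (if j = q then (1:ℝ) else 0) + (if j = q' then (1:ℝ) else 0) ≤ 2)
    (ht2 : ∀ j, (∑ h ∈ G2, ((b j h : ℝ) - y j h)) + (a1 j : ℝ) - x1 j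
      = (∑ j', (a1 j' : ℝ)) - r →
      ∑ h ∈ G2, (if f j = some h then (1:ℝ) else 0) + ∑ h ∈ G2, (if g j = some h then (1:ℝ) else 0)
        + (if j = p then (1:ℝ) else 0) + (if j = p' then (1:ℝ) else 0) ≤ 2) :
    ∃ δ : ℝ, 0 < δ ∧ δ ≤ ε ∧ ∃ y' x1' x2',
      FeasibleS G1 G2 b a1 a2 y' x1' x2' (r - δ) (w - δ) := by
  have hsum : ∀ (G : Finset M) j, ∑ h ∈ G, (((if f j = some h then (1:ℝ) else 0) +
      (if g j = some h then (1:ℝ) else 0)) / 2) =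
      (∑ h ∈ G, (if f j = some h then (1:ℝ) else 0) +
        ∑ h ∈ G, (if g j = some h then (1:ℝ) else 0)) / 2 := by
    intro G j
    rw [← Finset.sum_div, Finset.sum_add_distrib]
  have hcol : ∀ k : J → Option M, (∀ h, ∃ j, k j = some h ∧ ∀ j', k j' = some h → j' = j) →
      ∀ h, ∑ j, (if k j = some h then (1:ℝ) else 0) = 1 := by
    intro k hk h
    obtain ⟨j, hj, hu⟩ := hk h
    rw [Finset.sum_eq_single j]
    · simp [hj]
    · intro j' _ hne
      rw [if_neg fun hh => hne (hu j' hh)]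
    · simp
  have hrow : ∀ o : Option M, o ≠ none → ∑ h, (if o = some h then (1:ℝ) else 0) = 1 := by
    intro o ho
    cases o with
    | none => exact absurd rfl ho
    | some k => simp
  obtain ⟨δ, h0, h1, h2⟩ := exists_decrease G1 G2 b a1 a2 y x1 x2 r w hf hx ε hε
    (fun j h => ((if f j = some h then (1:ℝ) else 0) + (if g j = some h then (1:ℝ) else 0)) / 2)
    (fun j => ((if j = p then (1:ℝ) else 0) + (if j = p' then (1:ℝ) else 0)) / 2)
    (fun j => ((if j = q then (1:ℝ) else 0) + (if j = q' then (1:ℝ) else 0)) / 2)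
    (fun j h => by split_ifs <;> norm_num) (fun j h => by split_ifs <;> norm_num)
    (fun j h hh => by
      by_cases c1 : f j = some h
      · exact hfy j h c1
      by_cases c2 : g j = some h
      · exact hgy j h c2
      simp [c1, c2] at hh)
    (fun h => by rw [← Finset.sum_div, Finset.sum_add_distrib, hcol f hfc, hcol g hgc]; norm_num)
    (fun j => by
      rw [hsum]
      linarith [(sum_matching Finset.univ (f j)).1, (sum_matching Finset.univ (g j)).1])
    (fun j hj => by rw [hsum, hrow _ (hft j hj), hrow _ (hgt j hj)]; norm_num)
    (fun j => by split_ifs <;> norm_num) (fun j => by split_ifs <;> norm_num)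
    (fun j hh => by
      by_cases c1 : j = p
      · rwa [c1]
      by_cases c2 : j = p'
      · rwa [c2]
      simp [c1, c2] at hh)
    (fun j => by split_ifs <;> norm_num) (fun j => by split_ifs <;> norm_num)
    (fun j hh => by
      by_cases c1 : j = q
      · rwa [c1]
      by_cases c2 : j = q'
      · rwa [c2]
      simp [c1, c2] at hh)
    (by rw [← Finset.sum_div, Finset.sum_add_distrib]; simp)
    (by rw [← Finset.sum_div, Finset.sum_add_distrib]; simp)
    (fun j hj => by rw [hsum]; linarith [ht1 j hj])
    (fun j hj => by rw [hsum]; linarith [ht2 j hj])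
  exact ⟨δ, h0, h1, _, _, _, h2⟩

theorem no_e_crossing_of_strict
    {J M : Type*} [Fintype J] [Fintype M] [DecidableEq J] [DecidableEq M]
    (G1 G2 : Finset M) (hG1ne : G1.Nonempty) (hG2ne : G2.Nonempty)
    (hdisj : Disjoint G1 G2) (hcover : G1 ∪ G2 = Finset.univ)
    (b : J → M → ℕ) (a1 a2 : J → ℕ)
    (ystar : J → M → ℝ) (x1star x2star : J → ℝ) (rstar wstar : ℝ)
    (hstar : FeasibleS G1 G2 b a1 a2 ystar x1star x2star rstar wstar)
    (hstaropt : ∀ y' x1' x2' r' w', FeasibleS G1 G2 b a1 a2 y' x1' x2' r' w' →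
      wstar - rstar ≤ w' - r')
    (y : J → M → ℝ) (x1 x2 : J → ℝ) (r w : ℝ)
    (hfeas : FeasibleLP G1 G2 b a1 a2 rstar wstar y x1 x2 r w)
    (hopt : ∀ y' x1' x2' r' w',
      FeasibleLP G1 G2 b a1 a2 rstar wstar y' x1' x2' r' w' → r ≤ r')
    (ε : ℝ) (hε0 : 0 < ε) (hε1 : ε < 1) (hrε : r = (⌊rstar⌋ : ℝ) + ε)
    (hsat1 : ∀ h ∈ G1, ((∑ j, y j h) = w) ∧
      (w = (∑ j, (b j h : ℝ)) - ((∑ j, (a2 j : ℝ)) - r)))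
    (hsat2 : ∀ h ∈ G2, ((∑ j, y j h) = w) ∧
      (w = (∑ j, (b j h : ℝ)) - ((∑ j, (a1 j : ℝ)) - r)))
    (B1 B2 : Finset J)
    (hB1 : ∀ j, j ∈ B1 ↔ ¬∃ z : ℤ, x1 j = (z : ℝ))
    (hB2 : ∀ j, j ∈ B2 ↔ ¬∃ z : ℤ, x2 j = (z : ℝ))
    (hstrict : ∀ i ∈ B1 ∪ B2, x1 i + x2 i < r) :
    ∀ ja ∈ B1 ∪ B2, ¬(0 < x1 ja ∧ 0 < x2 ja ∧
      (B1 \ {ja}).Nonempty ∧ (B2 \ {ja}).Nonempty) := by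
  rintro ja hja ⟨hx1a, hx2a, ⟨j1, hj1⟩, ⟨j2, hj2⟩⟩
  rw [Finset.mem_sdiff, Finset.mem_singleton] at hj1 hj2
  obtain ⟨hj1B, hj1a⟩ := hj1
  obtain ⟨hj2B, hj2a⟩ := hj2
  obtain ⟨hf, hwr, hfl⟩ := hfeas
  have hf' := hf
  obtain ⟨-, -, f3, f4, -, -, f7, f8, f9, -, -⟩ := hf'
  have hnotint : ∀ z : ℤ, r ≠ (z : ℝ) := by
    intro z hz
    have e1 : (⌊rstar⌋ : ℝ) < (z : ℝ) := by linarith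
    have e2 : (z : ℝ) < (⌊rstar⌋ : ℝ) + 1 := by linarith
    have e3 : ⌊rstar⌋ < z := by exact_mod_cast e1
    have e4 : z < ⌊rstar⌋ + 1 := by exact_mod_cast e2
    omega
  have hx : ∀ j, x1 j + x2 j < r := by
    intro j
    by_cases hj : j ∈ B1 ∪ B2
    · exact hstrict j hj
    · rw [Finset.mem_union, not_or, hB1, hB2, not_not, not_not] at hj
      obtain ⟨⟨z1, hz1⟩, ⟨z2, hz2⟩⟩ := hj
      refine lt_of_le_of_ne (f7 j) fun heq => hnotint (z1 + z2) ?_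
      rw [← heq, hz1, hz2]; push_cast; ring
  have hcol : ∀ h, ∑ j, y j h = w := by
    intro h
    have hm : h ∈ G1 ∪ G2 := by rw [hcover]; exact Finset.mem_univ h
    rcases Finset.mem_union.1 hm with h1 | h1
    · exact (hsat1 h h1).1
    · exact (hsat2 h h1).1
  have hw : 0 < w := by
    obtain ⟨h, hh⟩ := hG1ne
    have h0 : 0 ≤ w := by
      rw [← hcol h]; exact Finset.sum_nonneg fun j _ => (f4 j h).1
    refine lt_of_le_of_ne h0 fun heq => hnotint (-⌈wstar - rstar⌉) ?_
    push_cast; linarith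
  have hx1j : 0 < x1 j1 := by
    refine lt_of_le_of_ne (f8 j1).1 fun heq => (hB1 j1).1 hj1B ⟨0, by simp [← heq]⟩
  have hx2j : 0 < x2 j2 := by
    refine lt_of_le_of_ne (f9 j2).1 fun heq => (hB2 j2).1 hj2B ⟨0, by simp [← heq]⟩
  -- no feasible decrease
  have hno : ¬ ∃ δ : ℝ, 0 < δ ∧ δ ≤ ε ∧ ∃ y' x1' x2',
      FeasibleS G1 G2 b a1 a2 y' x1' x2' (r - δ) (w - δ) := by
    rintro ⟨δ, h0, h1, y', x1', x2', hF⟩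
    have := hopt y' x1' x2' (r - δ) (w - δ) ⟨hF, by linarith, by linarith⟩
    linarith
  have mk := exists_good_matching y w hw (fun j h => (f4 j h).1) hcol f3
  -- the first matching
  have hf1 : ∃ f : J → Option M, (∀ j h, f j = some h → 0 < y j h) ∧
      (∀ j, ∑ h, y j h = w → f j ≠ none) ∧
      (∀ h, ∃ j, f j = some h ∧ ∀ j', f j' = some h → j' = j) ∧
      ((∑ h ∈ G2, ((b j1 h : ℝ) - y j1 h)) + (a1 j1 : ℝ) - x1 j1
        = (∑ j', (a1 j' : ℝ)) - r → ∀ h ∈ G2, f j1 ≠ some h) := by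
    by_cases ht : (∑ h ∈ G2, ((b j1 h : ℝ) - y j1 h)) + (a1 j1 : ℝ) - x1 j1
        = (∑ j', (a1 j' : ℝ)) - r
    · have hle : ∑ h ∈ G2, y j1 h ≤ w :=
        (Finset.sum_le_sum_of_subset_of_nonneg (Finset.subset_univ G2)
          (fun h _ _ => (f4 j1 h).1)).trans (f3 j1)
      have hlt : ∑ h ∈ G2, y j1 h < w := by
        refine lt_of_le_of_ne hle fun heq => (hB1 j1).1 hj1B
          ⟨∑ h ∈ G2, (b j1 h : ℤ) + a1 j1 - ∑ j', (a1 j' : ℤ) - ⌈wstar - rstar⌉, ?_⟩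
        rw [Finset.sum_sub_distrib, heq] at ht
        push_cast
        linarith
      obtain ⟨f, k1, k2, k3, k4⟩ := mk j1 G2 hlt
      exact ⟨f, k1, k2, k3, fun _ => k4⟩
    · obtain ⟨f, k1, k2, k3, k4⟩ := mk j1 ∅ (by simpa using hw)
      exact ⟨f, k1, k2, k3, fun h => absurd h ht⟩
  have hf2 : ∃ f : J → Option M, (∀ j h, f j = some h → 0 < y j h) ∧
      (∀ j, ∑ h, y j h = w → f j ≠ none) ∧
      (∀ h, ∃ j, f j = some h ∧ ∀ j', f j' = some h → j' = j) ∧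
      ((∑ h ∈ G1, ((b j2 h : ℝ) - y j2 h)) + (a2 j2 : ℝ) - x2 j2
        = (∑ j', (a2 j' : ℝ)) - r → ∀ h ∈ G1, f j2 ≠ some h) := by
    by_cases ht : (∑ h ∈ G1, ((b j2 h : ℝ) - y j2 h)) + (a2 j2 : ℝ) - x2 j2
        = (∑ j', (a2 j' : ℝ)) - r
    · have hle : ∑ h ∈ G1, y j2 h ≤ w :=
        (Finset.sum_le_sum_of_subset_of_nonneg (Finset.subset_univ G1)
          (fun h _ _ => (f4 j2 h).1)).trans (f3 j2)
      have hlt : ∑ h ∈ G1, y j2 h < w := by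
        refine lt_of_le_of_ne hle fun heq => (hB2 j2).1 hj2B
          ⟨∑ h ∈ G1, (b j2 h : ℤ) + a2 j2 - ∑ j', (a2 j' : ℤ) - ⌈wstar - rstar⌉, ?_⟩
        rw [Finset.sum_sub_distrib, heq] at ht
        push_cast
        linarith
      obtain ⟨f, k1, k2, k3, k4⟩ := mk j2 G1 hlt
      exact ⟨f, k1, k2, k3, fun _ => k4⟩
    · obtain ⟨f, k1, k2, k3, k4⟩ := mk j2 ∅ (by simpa using hw)
      exact ⟨f, k1, k2, k3, fun h => absurd h ht⟩
  obtain ⟨f, p1, p2, p3, p4⟩ := hf1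
  obtain ⟨g, q1, q2, q3, q4⟩ := hf2
  -- a job that is free for both sides in a single matching contradicts optimality
  have single : ∀ k : J → Option M, (∀ j h, k j = some h → 0 < y j h) →
      (∀ j, ∑ h, y j h = w → k j ≠ none) →
      (∀ h, ∃ j, k j = some h ∧ ∀ j', k j' = some h → j' = j) →
      ∀ s t, 0 < x1 s → 0 < x2 t →
      ((∑ h ∈ G2, ((b s h : ℝ) - y s h)) + (a1 s : ℝ) - x1 s
        = (∑ j', (a1 j' : ℝ)) - r → ∀ h ∈ G2, k s ≠ some h) →
      ((∑ h ∈ G1, ((b t h : ℝ) - y t h)) + (a2 t : ℝ) - x2 t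
        = (∑ j', (a2 j' : ℝ)) - r → ∀ h ∈ G1, k t ≠ some h) → False := by
    intro k k1 k2 k3 s t hs ht hs2 ht2
    refine hno (exists_decrease_matching G1 G2 b a1 a2 y x1 x2 r w hf hx ε hε0 k k
      k1 k1 k2 k2 k3 k3 s s t t hs hs ht ht ?_ ?_)
    · intro j hj
      by_cases hjt : j = t
      · subst hjt
        rw [(sum_matching G1 (k j)).2 (ht2 hj)]
        norm_num
      · simp only [if_neg hjt]
        linarith [(sum_matching G1 (k j)).1]
    · intro j hj
      by_cases hjt : j = s
      · subst hjt
        rw [(sum_matching G2 (k j)).2 (hs2 hj)]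
        norm_num
      · simp only [if_neg hjt]
        linarith [(sum_matching G2 (k j)).1]
  have hfa : ∀ h ∈ G2, f ja ≠ some h := by
    intro h hh hfj
    refine single f p1 p2 p3 j1 ja hx1j hx2a p4 fun _ h' hh' hfj' => ?_
    rw [hfj] at hfj'
    cases hfj'
    exact (Finset.disjoint_left.1 hdisj hh') hh
  have hga : ∀ h ∈ G1, g ja ≠ some h := by
    intro h hh hfj
    refine single g q1 q2 q3 ja j2 hx1a hx2j (fun _ h' hh' hfj' => ?_) q4
    rw [hfj] at hfj'
    cases hfj'
    exact (Finset.disjoint_left.1 hdisj hh) hh'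
  refine hno (exists_decrease_matching G1 G2 b a1 a2 y x1 x2 r w hf hx ε hε0 f g
      p1 q1 p2 q2 p3 q3 j1 ja j2 ja hx1j hx1a hx2j hx2a ?_ ?_)
  · intro j hj
    by_cases hja' : j = ja
    · subst hja'
      rw [(sum_matching G1 (g j)).2 hga, if_neg (Ne.symm hj2a), if_pos rfl]
      linarith [(sum_matching G1 (f j)).1]
    · by_cases hjt : j = j2
      · subst hjt
        rw [(sum_matching G1 (g j)).2 (q4 hj), if_pos rfl, if_neg hja']
        linarith [(sum_matching G1 (f j)).1]
      · rw [if_neg hja', if_neg hjt]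
        linarith [(sum_matching G1 (f j)).1, (sum_matching G1 (g j)).1]
  · intro j hj
    by_cases hja' : j = ja
    · subst hja'
      rw [(sum_matching G2 (f j)).2 hfa, if_neg (Ne.symm hj1a), if_pos rfl]
      linarith [(sum_matching G2 (g j)).1]
    · by_cases hjt : j = j1
      · subst hjt
        rw [(sum_matching G2 (f j)).2 (p4 hj), if_pos rfl, if_neg hja']
        linarith [(sum_matching G2 (g j)).1]
      · rw [if_neg hja', if_neg hjt]
        linarith [(sum_matching G2 (f j)).1, (sum_matching G2 (g j)).1]
end
end

section
/- For each g ∈ B1 and k ∈ B2: (1) every column in d(y,w) is of type (∗, k ; ∗, g) (k matched to G1 and g matched to G2) or of type (∗ ; ∗, k, g) (both k and g matched to G2) or of type (∗, k, g ; ∗) (both k and g matched to G1); (2) there is a column I_k of type (∗ ; ∗, k, g) in d(y,w) and a column I_g of type (∗, k, g ; ∗) in d(y,w). (3) Moreover, if there is a job i ∈ B1 ∪ B2 with x_{i1} + x_{i2} = r, then B1 = {i} or B2 = {i}. -/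
open Finset

noncomputable section

/-- A column matching: a matching of all machines to distinct jobs, using only
edges of the graph `G` (i.e. pairs with `y j h > 0`), and covering every
`d`-tight job (every job `j` with `∑ h, y j h = w`). -/
def IsColumn {J M : Type*} [Fintype M] (y : J → M → ℝ) (w : ℝ) (f : M → J) : Prop :=
  Function.Injective f ∧ (∀ h, 0 < y (f h) h) ∧
  (∀ j, ((∑ h, y j h) = w) → ∃ h, f h = j)

/-- `cols` together with multiplicities `mult` is a representation `d(y,w)` of the
part (d) of the solution as a set of columns. -/
def IsColRep {J M : Type*} [Fintype J] [Fintype M] [DecidableEq J]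
    (y : J → M → ℝ) (w : ℝ) (cols : Finset (M → J)) (mult : (M → J) → ℝ) : Prop :=
  (∀ f ∈ cols, IsColumn y w f ∧ 0 < mult f) ∧
  ((∑ f ∈ cols, mult f) = w) ∧
  (∀ j, ∀ h, y j h = ∑ f ∈ cols, if f h = j then mult f else 0)

/-- Alternating-path exchange inside one group of machines. -/
theorem path_switch {J M : Type*} (S : Finset M) (C B : M → J)
    (hC : Function.Injective C) (hB : Function.Injective B) (g : J)
    (hgB : ¬ ∃ h ∈ S, B h = g) :
    ∃ C' : M → J, (∀ h ∈ S, C' h = C h ∨ C' h = B h) ∧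
      (∀ h ∈ S, ∀ h' ∈ S, C' h = C' h' → h = h') ∧
      (∀ h ∈ S, C h ≠ g → ∃ h' ∈ S, C' h' = C h) ∧ (∀ h ∈ S, C' h ≠ g) := by
  classical
  by_cases hgC : ∃ h ∈ S, C h = g
  swap
  · exact ⟨C, fun _ _ => Or.inl rfl, fun _ _ _ _ e => hC e, fun h hh _ => ⟨h, hh, rfl⟩,
      fun h hh e => hgC ⟨h, hh, e⟩⟩
  obtain ⟨h1, hh1, rfl⟩ := hgC
  let T : M → Prop := Relation.ReflTransGen (fun h h' => h ∈ S ∧ h' ∈ S ∧ B h = C h') h1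
  have hT1 : T h1 := Relation.ReflTransGen.refl
  have hTs : ∀ h h', T h → h ∈ S → h' ∈ S → B h = C h' → T h' := fun h h' t a b c =>
    Relation.ReflTransGen.tail t ⟨a, b, c⟩
  have hTp : ∀ h', T h' → h' = h1 ∨ ∃ h, T h ∧ h ∈ S ∧ B h = C h' := by
    intro h' t
    rcases Relation.ReflTransGen.cases_tail t with e | ⟨c, tc, a, b, e⟩
    · exact Or.inl e
    · exact Or.inr ⟨c, tc, a, e⟩
  refine ⟨fun h => if T h then B h else C h, ?_, ?_, ?_, ?_⟩
  · intro h _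
    by_cases t : T h <;> simp [t]
  · intro h hh h' hh' e
    by_cases t : T h <;> by_cases t' : T h' <;> simp only [t, t', if_true, if_false] at e
    · exact hB e
    · exact absurd (hTs h h' t hh hh' e) t'
    · exact absurd (hTs h' h t' hh' hh e.symm) t
    · exact hC e
  · intro h hh hne
    by_cases t : T h
    · rcases hTp h t with rfl | ⟨c, tc, cS, e⟩
      · exact absurd rfl hne
      · exact ⟨c, cS, by simp [tc, e]⟩
    · exact ⟨h, hh, by simp [t]⟩
  · intro h hh
    by_cases t : T h
    · simp only [t, if_true]
      exact fun e => hgB ⟨h, hh, e⟩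
    · simp only [t, if_false]
      intro e
      exact t (hC e ▸ hT1)

/-- The (symmetric) abstract context extracted from an optimal solution. -/
structure Ctx {J M : Type*} [Fintype J] [Fintype M] (G1 G2 : Finset M) (y : J → M → ℝ)
    (x1 x2 : J → ℝ) (T1 T2 R D B1 B2 : J → Prop) (cols : Finset (M → J)) : Prop where
  cover : ∀ h, h ∈ G1 ∨ h ∈ G2
  disj : ∀ h, h ∈ G1 → h ∉ G2
  inj : ∀ f ∈ cols, Function.Injective f
  pos : ∀ f ∈ cols, ∀ h, 0 < y (f h) h
  covD : ∀ f ∈ cols, ∀ j, D j → ∃ h, f h = j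
  ne : cols.Nonempty
  F1 : ∀ g, B1 g → T2 g → ∃ f ∈ cols, ¬ ∃ h ∈ G2, f h = g
  F2 : ∀ k, B2 k → T1 k → ∃ f ∈ cols, ¬ ∃ h ∈ G1, f h = k
  posB1 : ∀ g, B1 g → 0 < x1 g
  posB2 : ∀ g, B2 g → 0 < x2 g
  R1 : ∀ i g, R i → g ≠ i → 0 < x1 g → 0 < x2 i
  R2 : ∀ i g, R i → g ≠ i → 0 < x2 g → 0 < x1 i
  RR1 : ∀ i i' j, R i → R i' → i' ≠ i → j ≠ i → 0 < x1 j → j = i'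
  RR2 : ∀ i i' j, R i → R i' → i' ≠ i → j ≠ i → 0 < x2 j → j = i'
  ND : ∀ (d : J → M → ℝ) (u1 u2 : J → ℝ), (∀ j h, y j h ≤ 0 → d j h ≤ 0) → (∀ j h, 0 ≤ d j h) →
    (∀ h, ∑ j, d j h = 1) → (∀ j, D j → 1 ≤ ∑ h ∈ G1, d j h + ∑ h ∈ G2, d j h) →
    (∀ j, x1 j ≤ 0 → u1 j ≤ 0) → (∀ j, x2 j ≤ 0 → u2 j ≤ 0) → (∀ j, 0 ≤ u1 j) → (∀ j, 0 ≤ u2 j) →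
    ∑ j, u1 j = 1 → ∑ j, u2 j = 1 → (∀ j, R j → 1 ≤ u1 j + u2 j) →
    (∀ j, T1 j → ∑ h ∈ G1, d j h + u2 j ≤ 1) →
    (∀ j, T2 j → ∑ h ∈ G2, d j h + u1 j ≤ 1) → False

theorem Ctx.swap {J M : Type*} [Fintype J] [Fintype M] {G1 G2 : Finset M} {y : J → M → ℝ}
    {x1 x2 : J → ℝ} {T1 T2 R D B1 B2 : J → Prop} {cols : Finset (M → J)}
    (c : Ctx G1 G2 y x1 x2 T1 T2 R D B1 B2 cols) : Ctx G2 G1 y x2 x1 T2 T1 R D B2 B1 cols where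
  cover h := (c.cover h).symm
  disj h a b := c.disj h b a
  inj := c.inj
  pos := c.pos
  covD := c.covD
  ne := c.ne
  F1 := c.F2
  F2 := c.F1
  posB1 := c.posB2
  posB2 := c.posB1
  R1 := c.R2
  R2 := c.R1
  RR1 := c.RR2
  RR2 := c.RR1
  ND d u1 u2 h1 h2 h3 h4 h5 h6 h7 h8 h9 h10 h11 h12 h13 :=
    c.ND d u2 u1 h1 h2 h3 (fun j hj => by linarith [h4 j hj]) h6 h5 h8 h7 h10 h9
      (fun j hj => by linarith [h11 j hj]) h13 h12

theorem sum_ind {J M : Type*} [DecidableEq J] (S : Finset M) (f : M → J)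
    (hf : ∀ h ∈ S, ∀ h' ∈ S, f h = f h' → h = h') (j : J) [Decidable (∃ h ∈ S, f h = j)] (c : ℝ) :
    ∑ h ∈ S, (if f h = j then c else 0) = if ∃ h ∈ S, f h = j then c else 0 := by
  classical
  split_ifs with hex
  · obtain ⟨h, hh, e⟩ := hex
    rw [Finset.sum_eq_single h]
    · simp [e]
    · intro h' hh' hne
      rw [if_neg]
      intro e'
      exact hne (hf _ hh' _ hh (e'.trans e.symm))
    · intro hn; exact absurd hh hn
  · apply Finset.sum_eq_zero
    intro h hh
    rw [if_neg]
    exact fun e => hex ⟨h, hh, e⟩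

open Classical in
/-- A half-half combination of two split columns cannot be a feasible direction. -/
theorem Ctx.half {J M : Type*} [Fintype J] [Fintype M] {G1 G2 : Finset M} {y : J → M → ℝ}
    {x1 x2 : J → ℝ} {T1 T2 R D B1 B2 : J → Prop} {cols : Finset (M → J)}
    (c : Ctx G1 G2 y x1 x2 T1 T2 R D B1 B2 cols)
    (P P' Q Q' : M → J) (g g' k k' : J)
    (hP : ∀ h ∈ G1, 0 < y (P h) h) (hP' : ∀ h ∈ G1, 0 < y (P' h) h)
    (hQ : ∀ h ∈ G2, 0 < y (Q h) h) (hQ' : ∀ h ∈ G2, 0 < y (Q' h) h)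
    (iP : ∀ h ∈ G1, ∀ h' ∈ G1, P h = P h' → h = h')
    (iP' : ∀ h ∈ G1, ∀ h' ∈ G1, P' h = P' h' → h = h')
    (iQ : ∀ h ∈ G2, ∀ h' ∈ G2, Q h = Q h' → h = h')
    (iQ' : ∀ h ∈ G2, ∀ h' ∈ G2, Q' h = Q' h' → h = h')
    (hD : ∀ j, D j → (∃ h ∈ G1, P h = j) ∨ (∃ h ∈ G2, Q h = j))
    (hD' : ∀ j, D j → (∃ h ∈ G1, P' h = j) ∨ (∃ h ∈ G2, Q' h = j))
    (hg : 0 < x1 g) (hg' : 0 < x1 g') (hk : 0 < x2 k) (hk' : 0 < x2 k')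
    (hR : ∀ j, R j → (2 : ℝ) ≤ (if j = g then 1 else 0) + (if j = g' then 1 else 0) +
      (if j = k then 1 else 0) + (if j = k' then 1 else 0))
    (h1 : ∀ j, T1 j → (if ∃ h ∈ G1, P h = j then 1 else 0) + (if ∃ h ∈ G1, P' h = j then 1 else 0) +
      (if j = k then 1 else 0) + (if j = k' then 1 else 0) ≤ (2 : ℝ))
    (h2 : ∀ j, T2 j → (if ∃ h ∈ G2, Q h = j then 1 else 0) + (if ∃ h ∈ G2, Q' h = j then 1 else 0) +
      (if j = g then 1 else 0) + (if j = g' then 1 else 0) ≤ (2 : ℝ)) : False := by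
  let E : M → J := fun h => if h ∈ G1 then P h else Q h
  let E' : M → J := fun h => if h ∈ G1 then P' h else Q' h
  let d : J → M → ℝ := fun j h => (1/2) * (if E h = j then 1 else 0) +
    (1/2) * (if E' h = j then 1 else 0)
  have hE : ∀ h, 0 < y (E h) h := by
    intro h
    by_cases hh : h ∈ G1
    · simpa [E, hh] using hP h hh
    · simpa [E, hh] using hQ h ((c.cover h).resolve_left hh)
  have hE' : ∀ h, 0 < y (E' h) h := by
    intro h
    by_cases hh : h ∈ G1
    · simpa [E', hh] using hP' h hh
    · simpa [E', hh] using hQ' h ((c.cover h).resolve_left hh)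
  have s1 : ∀ j, ∑ h ∈ G1, d j h = (1/2) * (if ∃ h ∈ G1, P h = j then 1 else 0) +
      (1/2) * (if ∃ h ∈ G1, P' h = j then 1 else 0) := by
    intro j
    rw [← sum_ind G1 P iP, ← sum_ind G1 P' iP', Finset.mul_sum, Finset.mul_sum,
      ← Finset.sum_add_distrib]
    refine Finset.sum_congr rfl fun h hh => ?_
    simp [d, E, E', hh]
  have s2 : ∀ j, ∑ h ∈ G2, d j h = (1/2) * (if ∃ h ∈ G2, Q h = j then 1 else 0) +
      (1/2) * (if ∃ h ∈ G2, Q' h = j then 1 else 0) := by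
    intro j
    rw [← sum_ind G2 Q iQ, ← sum_ind G2 Q' iQ', Finset.mul_sum, Finset.mul_sum,
      ← Finset.sum_add_distrib]
    refine Finset.sum_congr rfl fun h hh => ?_
    have : h ∉ G1 := fun a => c.disj h a hh
    simp [d, E, E', this]
  refine c.ND d (fun j => (1/2) * (if j = g then 1 else 0) + (1/2) * (if j = g' then 1 else 0))
    (fun j => (1/2) * (if j = k then 1 else 0) + (1/2) * (if j = k' then 1 else 0))
    ?_ ?_ ?_ ?_ ?_ ?_ ?_ ?_ ?_ ?_ ?_ ?_ ?_
  · intro j h hy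
    have a1 : E h ≠ j := by rintro rfl; linarith [hE h]
    have a2 : E' h ≠ j := by rintro rfl; linarith [hE' h]
    simp [d, a1, a2]
  · intro j h
    simp only [d]
    positivity
  · intro h
    simp only [d]
    rw [Finset.sum_add_distrib, ← Finset.mul_sum, ← Finset.mul_sum]
    simp
    norm_num
  · intro j hj
    rw [s1, s2]
    rcases hD j hj with q1 | q1 <;> rcases hD' j hj with q2 | q2 <;>
      rw [if_pos q1, if_pos q2] <;> split_ifs <;> norm_num
  · intro j hx
    have a1 : j ≠ g := by rintro rfl; linarith
    have a2 : j ≠ g' := by rintro rfl; linarith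
    simp [a1, a2]
  · intro j hx
    have a1 : j ≠ k := by rintro rfl; linarith
    have a2 : j ≠ k' := by rintro rfl; linarith
    simp [a1, a2]
  · intro j
    positivity
  · intro j
    positivity
  · rw [Finset.sum_add_distrib, ← Finset.mul_sum, ← Finset.mul_sum]
    simp
    norm_num
  · rw [Finset.sum_add_distrib, ← Finset.mul_sum, ← Finset.mul_sum]
    simp
    norm_num
  · intro j hj
    have := hR j hj
    linarith
  · intro j hj
    rw [s1]
    have := h1 j hj
    linarith
  · intro j hj
    rw [s2]
    have := h2 j hj
    linarith

/-- Single split column version. -/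
theorem Ctx.single {J M : Type*} [Fintype J] [Fintype M] {G1 G2 : Finset M} {y : J → M → ℝ}
    {x1 x2 : J → ℝ} {T1 T2 R D B1 B2 : J → Prop} {cols : Finset (M → J)}
    (c : Ctx G1 G2 y x1 x2 T1 T2 R D B1 B2 cols) (P Q : M → J) (g k : J)
    (hP : ∀ h ∈ G1, 0 < y (P h) h) (hQ : ∀ h ∈ G2, 0 < y (Q h) h)
    (iP : ∀ h ∈ G1, ∀ h' ∈ G1, P h = P h' → h = h')
    (iQ : ∀ h ∈ G2, ∀ h' ∈ G2, Q h = Q h' → h = h')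
    (hD : ∀ j, D j → (∃ h ∈ G1, P h = j) ∨ (∃ h ∈ G2, Q h = j))
    (hg : 0 < x1 g) (hk : 0 < x2 k) (hR : ∀ j, R j → j = g ∨ j = k) :
    (T1 k ∧ ∃ h ∈ G1, P h = k) ∨ (T2 g ∧ ∃ h ∈ G2, Q h = g) := by
  classical
  by_contra hcon
  refine c.half P P Q Q g g k k hP hP hQ hQ iP iP iQ iQ hD hD hg hg hk hk ?_ ?_ ?_
  · intro j hj
    rcases hR j hj with e | e <;> simp only [if_pos e] <;> split_ifs <;> norm_num
  · intro j hj
    by_cases e : j = k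
    · subst e
      have : ¬ ∃ h ∈ G1, P h = j := fun q => hcon (Or.inl ⟨hj, q⟩)
      rw [if_neg this]; norm_num
    · simp only [e, if_false]
      split_ifs <;> norm_num
  · intro j hj
    by_cases e : j = g
    · subst e
      have : ¬ ∃ h ∈ G2, Q h = j := fun q => hcon (Or.inr ⟨hj, q⟩)
      rw [if_neg this]; norm_num
    · simp only [e, if_false]
      split_ifs <;> norm_num

theorem Ctx.cov {J M : Type*} [Fintype J] [Fintype M] {G1 G2 : Finset M} {y : J → M → ℝ}
    {x1 x2 : J → ℝ} {T1 T2 R D B1 B2 : J → Prop} {cols : Finset (M → J)}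
    (c : Ctx G1 G2 y x1 x2 T1 T2 R D B1 B2 cols) (f : M → J) (hf : f ∈ cols) (j : J) (hj : D j) :
    (∃ h ∈ G1, f h = j) ∨ (∃ h ∈ G2, f h = j) := by
  obtain ⟨h, e⟩ := c.covD f hf j hj
  rcases c.cover h with a | a
  · exact Or.inl ⟨h, a, e⟩
  · exact Or.inr ⟨h, a, e⟩

theorem Ctx.excl {J M : Type*} [Fintype J] [Fintype M] {G1 G2 : Finset M} {y : J → M → ℝ}
    {x1 x2 : J → ℝ} {T1 T2 R D B1 B2 : J → Prop} {cols : Finset (M → J)}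
    (c : Ctx G1 G2 y x1 x2 T1 T2 R D B1 B2 cols) (f : M → J) (hf : f ∈ cols) (j : J) :
    ¬ ((∃ h ∈ G1, f h = j) ∧ (∃ h ∈ G2, f h = j)) := by
  rintro ⟨⟨h, a, e⟩, ⟨h', a', e'⟩⟩
  have := c.inj f hf (e.trans e'.symm)
  subst this
  exact c.disj h a a'

theorem Ctx.col {J M : Type*} [Fintype J] [Fintype M] {G1 G2 : Finset M} {y : J → M → ℝ}
    {x1 x2 : J → ℝ} {T1 T2 R D B1 B2 : J → Prop} {cols : Finset (M → J)}
    (c : Ctx G1 G2 y x1 x2 T1 T2 R D B1 B2 cols) (g k : J)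
    (hg : 0 < x1 g) (hk : 0 < x2 k) (hR : ∀ j, R j → j = g ∨ j = k) (f : M → J) (hf : f ∈ cols) :
    (T1 k ∧ ∃ h ∈ G1, f h = k) ∨ (T2 g ∧ ∃ h ∈ G2, f h = g) :=
  c.single f f g k (fun h _ => c.pos f hf h) (fun h _ => c.pos f hf h)
    (fun _ _ _ _ e => c.inj f hf e) (fun _ _ _ _ e => c.inj f hf e) (c.cov f hf) hg hk hR

theorem Ctx.dtight {J M : Type*} [Fintype J] [Fintype M] {G1 G2 : Finset M} {y : J → M → ℝ}
    {x1 x2 : J → ℝ} {T1 T2 R D B1 B2 : J → Prop} {cols : Finset (M → J)}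
    (c : Ctx G1 G2 y x1 x2 T1 T2 R D B1 B2 cols) (g k : J)
    (hg : 0 < x1 g) (hk : 0 < x2 k) (hR : ∀ j, R j → j = g ∨ j = k)
    (C B : M → J) (hC : C ∈ cols) (hB : B ∈ cols) (hkC : ¬ ∃ h ∈ G1, C h = k)
    (hgB : ¬ ∃ h ∈ G2, B h = g) : D g := by
  by_contra hDg
  obtain ⟨C', e1, e2, e3, e4⟩ := path_switch G2 C B (c.inj C hC) (c.inj B hB) g hgB
  have w1 : ∀ h ∈ G2, 0 < y (C' h) h := by
    intro h hh
    rcases e1 h hh with e | e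
    · rw [e]; exact c.pos C hC h
    · rw [e]; exact c.pos B hB h
  have w2 : ∀ j, D j → (∃ h ∈ G1, C h = j) ∨ (∃ h ∈ G2, C' h = j) := by
    intro j hj
    rcases c.cov C hC j hj with h | ⟨h, hh, e⟩
    · exact Or.inl h
    · right
      subst e
      apply e3 h hh
      rintro rfl
      exact hDg hj
  rcases c.single C C' g k (fun h _ => c.pos C hC h) w1 (fun _ _ _ _ e => c.inj C hC e) e2 w2
    hg hk hR with h | ⟨_, h, hh, e⟩
  · exact hkC h.2
  · exact e4 h hh e

theorem Ctx.pair {J M : Type*} [Fintype J] [Fintype M] {G1 G2 : Finset M} {y : J → M → ℝ}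
    {x1 x2 : J → ℝ} {T1 T2 R D B1 B2 : J → Prop} {cols : Finset (M → J)}
    (c : Ctx G1 G2 y x1 x2 T1 T2 R D B1 B2 cols) (g k : J)
    (hg : B1 g) (hk : B2 k) (hR : ∀ j, R j → j = g ∨ j = k) :
    T1 k ∧ T2 g ∧ D g ∧ D k ∧ (∀ f ∈ cols, (∃ h ∈ G1, f h = k) ∨ (∃ h ∈ G2, f h = g)) ∧
      (∃ f ∈ cols, ¬ ∃ h ∈ G1, f h = k) ∧ (∃ f ∈ cols, ¬ ∃ h ∈ G2, f h = g) := by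
  have hcol := c.col g k (c.posB1 g hg) (c.posB2 k hk) hR
  obtain ⟨f0, hf0⟩ := c.ne
  have t1 : T1 k := by
    by_contra t
    have ha : ∀ f ∈ cols, T2 g ∧ ∃ h ∈ G2, f h = g := fun f hf =>
      (hcol f hf).resolve_left (fun q => t q.1)
    obtain ⟨f, hf, hn⟩ := c.F1 g hg (ha f0 hf0).1
    exact hn (ha f hf).2
  have t2 : T2 g := by
    by_contra t
    have ha : ∀ f ∈ cols, T1 k ∧ ∃ h ∈ G1, f h = k := fun f hf =>
      (hcol f hf).resolve_right (fun q => t q.1)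
    obtain ⟨f, hf, hn⟩ := c.F2 k hk (ha f0 hf0).1
    exact hn (ha f hf).2
  obtain ⟨B, hB, hgB⟩ := c.F1 g hg t2
  obtain ⟨C, hC, hkC⟩ := c.F2 k hk t1
  refine ⟨t1, t2, ?_, ?_, ?_, ⟨C, hC, hkC⟩, ⟨B, hB, hgB⟩⟩
  · exact c.dtight g k (c.posB1 g hg) (c.posB2 k hk) hR C B hC hB hkC hgB
  · exact c.swap.dtight k g (c.posB2 k hk) (c.posB1 g hg) (fun j hj => (hR j hj).symm)
      B C hB hC hgB hkC
  · intro f hf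
    exact (hcol f hf).imp (fun q => q.2) (fun q => q.2)

theorem Ctx.three {J M : Type*} [Fintype J] [Fintype M] {G1 G2 : Finset M} {y : J → M → ℝ}
    {x1 x2 : J → ℝ} {T1 T2 R D B1 B2 : J → Prop} {cols : Finset (M → J)}
    (c : Ctx G1 G2 y x1 x2 T1 T2 R D B1 B2 cols) (i g k : J) (hi : R i) (hiB : B1 i)
    (hg : B1 g) (hgi : g ≠ i) (hk : B2 k) (hki : k ≠ i) : False := by
  classical
  have pg := c.posB1 g hg
  have pk := c.posB2 k hk
  have pi1 := c.posB1 i hiB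
  have pi2 := c.R1 i g hi hgi pg
  have hR1 : ∀ j, R j → j ≠ i → j = g := fun j hj hne => (c.RR1 i j g hi hj hne hgi pg).symm
  have hR2 : ∀ j, R j → j ≠ i → j = k := fun j hj hne => (c.RR2 i j k hi hj hne hki pk).symm
  obtain ⟨t1, t2, Di, Dk, hcol, ⟨C, hC, hkC⟩, -⟩ := c.pair i k hiB hk
    (fun j hj => or_iff_not_imp_left.2 (hR2 j hj))
  have hR1' : ∀ j, R j → j = g ∨ j = i := fun j hj => (or_iff_not_imp_left.2 (hR1 j hj)).symm
  have hcol2 := c.col g i pg pi2 hR1'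
  have iC2 := (hcol C hC).resolve_left hkC
  have iC1 : ¬ ∃ h ∈ G1, C h = i := fun q => c.excl C hC i ⟨q, iC2⟩
  have gC := (hcol2 C hC).resolve_left (fun q => iC1 q.2)
  obtain ⟨B, hB, hgB⟩ := c.F1 g hg gC.1
  have Dg := c.dtight g i pg pi2 hR1' C B hC hB iC1 hgB
  have iB1 := ((hcol2 B hB).resolve_right (fun q => hgB q.2)).2
  have iB2 : ¬ ∃ h ∈ G2, B h = i := fun q => c.excl B hB i ⟨iB1, q⟩
  have kB1 := (hcol B hB).resolve_right iB2
  refine c.half B C B C i g k i (fun h _ => c.pos B hB h) (fun h _ => c.pos C hC h)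
    (fun h _ => c.pos B hB h) (fun h _ => c.pos C hC h)
    (fun _ _ _ _ e => c.inj B hB e) (fun _ _ _ _ e => c.inj C hC e)
    (fun _ _ _ _ e => c.inj B hB e) (fun _ _ _ _ e => c.inj C hC e)
    (c.cov B hB) (c.cov C hC) pi1 pg pk pi2 ?_ ?_ ?_
  · intro j hj
    by_cases e : j = i
    · simp only [e, if_true]
      split_ifs <;> norm_num
    · have e1 := hR1 j hj e
      have e2 := hR2 j hj e
      simp only [if_pos e1, if_pos e2]
      split_ifs <;> norm_num
  · intro j _
    by_cases e : j = i
    · subst e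
      rw [if_neg iC1, if_neg hki.symm]
      split_ifs <;> norm_num
    · by_cases e' : j = k
      · subst e'
        rw [if_neg hkC, if_neg hki]
        split_ifs <;> norm_num
      · rw [if_neg e, if_neg e']
        split_ifs <;> norm_num
  · intro j _
    by_cases e : j = i
    · subst e
      rw [if_neg iB2, if_neg hgi.symm]
      split_ifs <;> norm_num
    · by_cases e' : j = g
      · subst e'
        rw [if_neg hgB, if_neg hgi]
        split_ifs <;> norm_num
      · rw [if_neg e, if_neg e']
        split_ifs <;> norm_num

open Filter Topology in
theorem ev_small (s k : ℝ) (hs : 0 ≤ s) (hk : s ≤ 0 → k ≤ 0) :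
    ∀ᶠ δ in 𝓝[>] (0 : ℝ), δ * k ≤ s := by
  rcases hs.lt_or_eq with h | h
  · have : Tendsto (fun δ : ℝ => δ * k) (𝓝[>] 0) (𝓝 (0 * k)) :=
      ((continuous_id.mul continuous_const).tendsto 0).mono_left nhdsWithin_le_nhds
    rw [zero_mul] at this
    exact (this.eventually (gt_mem_nhds h)).mono fun _ h => le_of_lt h
  · filter_upwards [self_mem_nhdsWithin] with δ hδ
    have : (0 : ℝ) < δ := hδ
    nlinarith [hk h.ge]

open Filter Topology in
/-- An optimal fractional solution admits no improving direction. -/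
theorem no_dir {J M : Type*} [Fintype J] [Fintype M] [DecidableEq M]
    (G1 G2 : Finset M)
    (hdisj : Disjoint G1 G2) (hcover : G1 ∪ G2 = Finset.univ)
    (b : J → M → ℕ) (a1 a2 : J → ℕ) (rstar wstar : ℝ)
    (y : J → M → ℝ) (x1 x2 : J → ℝ) (r w : ℝ)
    (hfeas : FeasibleLP G1 G2 b a1 a2 rstar wstar y x1 x2 r w)
    (hopt : ∀ y' x1' x2' r' w',
      FeasibleLP G1 G2 b a1 a2 rstar wstar y' x1' x2' r' w' → r ≤ r')
    (hr : (⌊rstar⌋ : ℝ) < r)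
    (d : J → M → ℝ) (u1 u2 : J → ℝ) (c1 : ∀ j h, y j h ≤ 0 → d j h ≤ 0) (c2 : ∀ j h, 0 ≤ d j h)
    (c3 : ∀ h, ∑ j, d j h = 1)
    (c4 : ∀ j, ∑ h, y j h = w → 1 ≤ ∑ h ∈ G1, d j h + ∑ h ∈ G2, d j h)
    (c5 : ∀ j, x1 j ≤ 0 → u1 j ≤ 0) (c6 : ∀ j, x2 j ≤ 0 → u2 j ≤ 0)
    (c7 : ∀ j, 0 ≤ u1 j) (c8 : ∀ j, 0 ≤ u2 j)
    (c9 : ∑ j, u1 j = 1) (c10 : ∑ j, u2 j = 1) (c11 : ∀ j, x1 j + x2 j = r → 1 ≤ u1 j + u2 j)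
    (c12 : ∀ j, (∑ h ∈ G1, ((b j h : ℝ) - y j h)) + (a2 j : ℝ) - x2 j = (∑ j', (a2 j' : ℝ)) - r →
      ∑ h ∈ G1, d j h + u2 j ≤ 1)
    (c13 : ∀ j, (∑ h ∈ G2, ((b j h : ℝ) - y j h)) + (a1 j : ℝ) - x1 j = (∑ j', (a1 j' : ℝ)) - r →
      ∑ h ∈ G2, d j h + u1 j ≤ 1) : False := by
  obtain ⟨⟨f1, f2, f3, f4, f5, f6, f7, f8, f9, f10, f11⟩, f12, f13⟩ := hfeas
  have split : ∀ j, ∑ h, d j h = ∑ h ∈ G1, d j h + ∑ h ∈ G2, d j h := by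
    intro j
    rw [← hcover, Finset.sum_union hdisj]
  have e1 : ∀ᶠ δ in 𝓝[>] (0 : ℝ), ∀ j h, δ * d j h ≤ y j h :=
    eventually_all.2 fun j => eventually_all.2 fun h => ev_small _ _ (f4 j h).1 (c1 j h)
  have e2 : ∀ᶠ δ in 𝓝[>] (0 : ℝ), ∀ j, δ * (1 - ∑ h, d j h) ≤ w - ∑ h, y j h :=
    eventually_all.2 fun j => ev_small _ _ (by linarith [f3 j]) (fun q => by
      rw [split]; linarith [c4 j (by linarith [f3 j])])
  have e3 : ∀ᶠ δ in 𝓝[>] (0 : ℝ), ∀ j, δ * u1 j ≤ x1 j :=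
    eventually_all.2 fun j => ev_small _ _ (f8 j).1 (c5 j)
  have e4 : ∀ᶠ δ in 𝓝[>] (0 : ℝ), ∀ j, δ * u2 j ≤ x2 j :=
    eventually_all.2 fun j => ev_small _ _ (f9 j).1 (c6 j)
  have e5 : ∀ᶠ δ in 𝓝[>] (0 : ℝ), ∀ j, δ * (1 - (u1 j + u2 j)) ≤ r - (x1 j + x2 j) :=
    eventually_all.2 fun j => ev_small _ _ (by linarith [f7 j]) (fun q => by
      linarith [c11 j (by linarith [f7 j])])
  have e6 : ∀ᶠ δ in 𝓝[>] (0 : ℝ), ∀ j, δ * (∑ h ∈ G1, d j h + u2 j - 1) ≤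
      (∑ j', (a2 j' : ℝ)) - r - ((∑ h ∈ G1, ((b j h : ℝ) - y j h)) + (a2 j : ℝ) - x2 j) :=
    eventually_all.2 fun j => ev_small _ _ (by linarith [f10 j]) (fun q => by
      linarith [c12 j (by linarith [f10 j])])
  have e7 : ∀ᶠ δ in 𝓝[>] (0 : ℝ), ∀ j, δ * (∑ h ∈ G2, d j h + u1 j - 1) ≤
      (∑ j', (a1 j' : ℝ)) - r - ((∑ h ∈ G2, ((b j h : ℝ) - y j h)) + (a1 j : ℝ) - x1 j) :=
    eventually_all.2 fun j => ev_small _ _ (by linarith [f11 j]) (fun q => by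
      linarith [c13 j (by linarith [f11 j])])
  have e8 : ∀ᶠ δ in 𝓝[>] (0 : ℝ), δ * 1 ≤ r - ⌊rstar⌋ :=
    ev_small _ _ (by linarith) (fun q => by linarith)
  have e9 : ∀ᶠ δ in 𝓝[>] (0 : ℝ), 0 < δ := self_mem_nhdsWithin
  obtain ⟨δ, p1, p2, p3, p4, p5, p6, p7, p8, p9⟩ :=
    (e1.and (e2.and (e3.and (e4.and (e5.and (e6.and (e7.and (e8.and e9)))))))).exists
  have key := hopt (fun j h => y j h - δ * d j h) (fun j => x1 j - δ * u1 j)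
    (fun j => x2 j - δ * u2 j) (r - δ) (w - δ) ?_
  · linarith
  have m : ∀ h, ∑ j, (y j h - δ * d j h) = ∑ j, y j h - δ := by
    intro h
    rw [Finset.sum_sub_distrib, ← Finset.mul_sum, c3, mul_one]
  refine ⟨⟨?_, ?_, ?_, ?_, ?_, ?_, ?_, ?_, ?_, ?_, ?_⟩, ?_, ?_⟩
  · intro h hh
    rw [m]
    constructor <;> linarith [(f1 h hh).1, (f1 h hh).2]
  · intro h hh
    rw [m]
    constructor <;> linarith [(f2 h hh).1, (f2 h hh).2]
  · intro j
    rw [Finset.sum_sub_distrib, ← Finset.mul_sum]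
    linarith [p2 j]
  · intro j h
    have := mul_nonneg p9.le (c2 j h)
    constructor <;> linarith [p1 j h, (f4 j h).2]
  · rw [Finset.sum_sub_distrib, ← Finset.mul_sum, c9, f5, mul_one]
  · rw [Finset.sum_sub_distrib, ← Finset.mul_sum, c10, f6, mul_one]
  · intro j
    linarith [p5 j]
  · intro j
    have := mul_nonneg p9.le (c7 j)
    constructor <;> linarith [p3 j, (f8 j).2]
  · intro j
    have := mul_nonneg p9.le (c8 j)
    constructor <;> linarith [p4 j, (f9 j).2]
  · intro j
    have : ∑ h ∈ G1, ((b j h : ℝ) - (y j h - δ * d j h)) =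
        ∑ h ∈ G1, ((b j h : ℝ) - y j h) + δ * ∑ h ∈ G1, d j h := by
      rw [Finset.mul_sum, ← Finset.sum_add_distrib]
      exact Finset.sum_congr rfl fun _ _ => by ring
    rw [this]
    linarith [p6 j]
  · intro j
    have : ∑ h ∈ G2, ((b j h : ℝ) - (y j h - δ * d j h)) =
        ∑ h ∈ G2, ((b j h : ℝ) - y j h) + δ * ∑ h ∈ G2, d j h := by
      rw [Finset.mul_sum, ← Finset.sum_add_distrib]
      exact Finset.sum_congr rfl fun _ _ => by ring
    rw [this]
    linarith [p7 j]
  · linarith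
  · linarith

/-- If every column matches `k` into `S`, the load of `k` on `S` is `w`. -/
theorem all_load {J M : Type*} [Fintype J] [Fintype M] [DecidableEq J]
    (y : J → M → ℝ) (w : ℝ) (cols : Finset (M → J)) (mult : (M → J) → ℝ)
    (hrep : IsColRep y w cols mult) (S : Finset M) (k : J)
    (hall : ∀ f ∈ cols, ∃ h ∈ S, f h = k) : ∑ h ∈ S, y k h = w := by
  classical
  obtain ⟨q1, q2, q3⟩ := hrep
  simp_rw [q3 k]
  rw [Finset.sum_comm, ← q2]
  refine Finset.sum_congr rfl fun f hf => ?_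
  rw [sum_ind S f (fun _ _ _ _ e => (q1 f hf).1.1 e) k, if_pos (hall f hf)]

/-- Fractional jobs with a tight constraint are not always matched into `S`. -/
theorem frac_fact {J M : Type*} [Fintype J] [Fintype M] [DecidableEq J]
    (y : J → M → ℝ) (w r : ℝ) (cols : Finset (M → J)) (mult : (M → J) → ℝ)
    (hrep : IsColRep y w cols mult) (S : Finset M) (k : J) (b : J → M → ℕ) (a : J → ℕ)
    (x : J → ℝ) (n : ℤ) (hwr : w - r = n) (hx : ¬ ∃ z : ℤ, x k = z)
    (ht : (∑ h ∈ S, ((b k h : ℝ) - y k h)) + (a k : ℝ) - x k = (∑ j', (a j' : ℝ)) - r) :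
    ∃ f ∈ cols, ¬ ∃ h ∈ S, f h = k := by
  by_contra hcon
  push Not at hcon
  have := all_load y w cols mult hrep S k hcon
  rw [Finset.sum_sub_distrib, this] at ht
  refine hx ⟨(∑ h ∈ S, (b k h : ℤ)) + a k - (∑ j', (a j' : ℤ)) - n, ?_⟩
  push_cast
  linarith

theorem exists_frac {J : Type*} [Fintype J] (x : J → ℝ) (hr : ¬ ∃ z : ℤ, ∑ j, x j = z) :
    ∃ j, ¬ ∃ z : ℤ, x j = z := by
  by_contra hcon
  push Not at hcon
  choose z hz using hcon
  exact hr ⟨∑ j, z j, by push_cast; exact Finset.sum_congr rfl fun j _ => hz j⟩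

theorem column_characterization
    {J M : Type*} [Fintype J] [Fintype M] [DecidableEq J] [DecidableEq M]
    (G1 G2 : Finset M) (hG1ne : G1.Nonempty) (hG2ne : G2.Nonempty)
    (hdisj : Disjoint G1 G2) (hcover : G1 ∪ G2 = Finset.univ)
    (b : J → M → ℕ) (a1 a2 : J → ℕ)
    (ystar : J → M → ℝ) (x1star x2star : J → ℝ) (rstar wstar : ℝ)
    (hstar : FeasibleS G1 G2 b a1 a2 ystar x1star x2star rstar wstar)
    (hstaropt : ∀ y' x1' x2' r' w', FeasibleS G1 G2 b a1 a2 y' x1' x2' r' w' →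
      wstar - rstar ≤ w' - r')
    (y : J → M → ℝ) (x1 x2 : J → ℝ) (r w : ℝ)
    (hfeas : FeasibleLP G1 G2 b a1 a2 rstar wstar y x1 x2 r w)
    (hopt : ∀ y' x1' x2' r' w',
      FeasibleLP G1 G2 b a1 a2 rstar wstar y' x1' x2' r' w' → r ≤ r')
    (ε : ℝ) (hε0 : 0 < ε) (hε1 : ε < 1) (hrε : r = (⌊rstar⌋ : ℝ) + ε)
    (hsat1 : ∀ h ∈ G1, ((∑ j, y j h) = w) ∧
      (w = (∑ j, (b j h : ℝ)) - ((∑ j, (a2 j : ℝ)) - r)))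
    (hsat2 : ∀ h ∈ G2, ((∑ j, y j h) = w) ∧
      (w = (∑ j, (b j h : ℝ)) - ((∑ j, (a1 j : ℝ)) - r)))
    (B1 B2 : Finset J)
    (hB1 : ∀ j, j ∈ B1 ↔ ¬∃ z : ℤ, x1 j = (z : ℝ))
    (hB2 : ∀ j, j ∈ B2 ↔ ¬∃ z : ℤ, x2 j = (z : ℝ))
    (cols : Finset (M → J)) (mult : (M → J) → ℝ)
    (hrep : IsColRep y w cols mult)
    :
    (∀ g ∈ B1, ∀ k ∈ B2,
      (∀ f ∈ cols,
        ((∃ h ∈ G1, f h = k) ∧ (∃ h ∈ G2, f h = g)) ∨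
        ((∃ h ∈ G2, f h = k) ∧ (∃ h ∈ G2, f h = g)) ∨
        ((∃ h ∈ G1, f h = k) ∧ (∃ h ∈ G1, f h = g))) ∧
      (∃ f ∈ cols, (∃ h ∈ G2, f h = k) ∧ (∃ h ∈ G2, f h = g)) ∧
      (∃ f ∈ cols, (∃ h ∈ G1, f h = k) ∧ (∃ h ∈ G1, f h = g))) ∧
    (∀ i ∈ B1 ∪ B2, x1 i + x2 i = r → B1 = {i} ∨ B2 = {i}) := by
  have hF := hfeas
  obtain ⟨⟨f1, f2, f3, f4, f5, f6, f7, f8, f9, f10, f11⟩, f12, f13⟩ := hF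
  have hr : ¬ ∃ z : ℤ, r = z := by
    rintro ⟨z, hz⟩
    have a : (⌊rstar⌋ : ℝ) < z := by linarith
    have b : (z : ℝ) < ⌊rstar⌋ + 1 := by linarith
    norm_cast at a b
    omega
  have two : ∀ i i', i' ≠ i → x1 i + x2 i + (x1 i' + x2 i') ≤ 2 * r := by
    intro i i' hne
    have e : ∑ j, (x1 j + x2 j) = 2 * r := by rw [Finset.sum_add_distrib, f5, f6]; ring
    rw [← e, ← Finset.sum_pair (f := fun j => x1 j + x2 j) hne.symm]
    exact Finset.sum_le_sum_of_subset_of_nonneg (Finset.subset_univ _)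
      (fun j _ _ => by linarith [(f8 j).1, (f9 j).1])
  have three : ∀ i i' j, i' ≠ i → j ≠ i → j ≠ i' →
      x1 i + x2 i + (x1 i' + x2 i') + (x1 j + x2 j) ≤ 2 * r := by
    intro i i' j hne h1 h2
    have e : ∑ j, (x1 j + x2 j) = 2 * r := by rw [Finset.sum_add_distrib, f5, f6]; ring
    have e3 : ∑ t ∈ ({i, i', j} : Finset J), (x1 t + x2 t) =
        x1 i + x2 i + (x1 i' + x2 i') + (x1 j + x2 j) := by
      rw [Finset.sum_insert (by simp [hne.symm, h1.symm]), Finset.sum_pair h2.symm]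
      ring
    rw [← e, ← e3]
    exact Finset.sum_le_sum_of_subset_of_nonneg (Finset.subset_univ _)
      (fun j _ _ => by linarith [(f8 j).1, (f9 j).1])
  have pair1 : ∀ i g, g ≠ i → x1 i + x1 g ≤ r := by
    intro i g hne
    rw [← f5, ← Finset.sum_pair (f := x1) hne.symm]
    exact Finset.sum_le_sum_of_subset_of_nonneg (Finset.subset_univ _) (fun j _ _ => (f8 j).1)
  have pair2 : ∀ i g, g ≠ i → x2 i + x2 g ≤ r := by
    intro i g hne
    rw [← f6, ← Finset.sum_pair (f := x2) hne.symm]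
    exact Finset.sum_le_sum_of_subset_of_nonneg (Finset.subset_univ _) (fun j _ _ => (f9 j).1)
  have c : Ctx G1 G2 y x1 x2
      (fun j => (∑ h ∈ G1, ((b j h : ℝ) - y j h)) + (a2 j : ℝ) - x2 j = (∑ j', (a2 j' : ℝ)) - r)
      (fun j => (∑ h ∈ G2, ((b j h : ℝ) - y j h)) + (a1 j : ℝ) - x1 j = (∑ j', (a1 j' : ℝ)) - r)
      (fun j => x1 j + x2 j = r) (fun j => ∑ h, y j h = w) (fun j => j ∈ B1) (fun j => j ∈ B2)
      cols := by
    refine ⟨?_, ?_, ?_, ?_, ?_, ?_, ?_, ?_, ?_, ?_, ?_, ?_, ?_, ?_, ?_⟩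
    · intro h
      have : h ∈ G1 ∪ G2 := by rw [hcover]; exact Finset.mem_univ h
      exact Finset.mem_union.1 this
    · intro h a b
      exact Finset.disjoint_left.1 hdisj a b
    · exact fun f hf => (hrep.1 f hf).1.1
    · exact fun f hf => (hrep.1 f hf).1.2.1
    · exact fun f hf => (hrep.1 f hf).1.2.2
    · rw [Finset.nonempty_iff_ne_empty]
      intro e
      have := hrep.2.1
      rw [e, Finset.sum_empty] at this
      exact hr ⟨-⌈wstar - rstar⌉, by push_cast; linarith⟩
    · intro g hg ht
      exact frac_fact y w r cols mult hrep G2 g b a1 x1 _ f12 ((hB1 g).1 hg) ht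
    · intro g hg ht
      exact frac_fact y w r cols mult hrep G1 g b a2 x2 _ f12 ((hB2 g).1 hg) ht
    · intro g hg
      refine lt_of_le_of_ne (f8 g).1 (fun e => (hB1 g).1 hg ⟨0, by simp [← e]⟩)
    · intro g hg
      refine lt_of_le_of_ne (f9 g).1 (fun e => (hB2 g).1 hg ⟨0, by simp [← e]⟩)
    · intro i g hi hne hg
      linarith [pair1 i g hne]
    · intro i g hi hne hg
      linarith [pair2 i g hne]
    · intro i i' j hi hi' hne hj hx
      by_contra h
      linarith [three i i' j hne hj h, (f9 j).1]
    · intro i i' j hi hi' hne hj hx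
      by_contra h
      linarith [three i i' j hne hj h, (f8 j).1]
    · intro d u1 u2
      exact no_dir G1 G2 hdisj hcover b a1 a2 rstar wstar y x1 x2 r w hfeas hopt (by linarith) d u1 u2
  have exB1 : ∃ g, g ∈ B1 := by
    obtain ⟨j, hj⟩ := exists_frac x1 (by rw [f5]; exact hr)
    exact ⟨j, (hB1 j).2 hj⟩
  have exB2 : ∃ g, g ∈ B2 := by
    obtain ⟨j, hj⟩ := exists_frac x2 (by rw [f6]; exact hr)
    exact ⟨j, (hB2 j).2 hj⟩
  have other : ∀ (B : Finset J) (i : J), (∃ g, g ∈ B) → B ≠ {i} → ∃ g ∈ B, g ≠ i := by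
    rintro B i ⟨g, hg⟩ hne
    by_contra hcon
    push Not at hcon
    apply hne
    exact Finset.eq_singleton_iff_unique_mem.2 ⟨hcon g hg ▸ hg, hcon⟩
  have part3 : ∀ i ∈ B1 ∪ B2, x1 i + x2 i = r → B1 = {i} ∨ B2 = {i} := by
    intro i hi hir
    by_contra hcon
    push Not at hcon
    obtain ⟨g, hg, hgi⟩ := other B1 i exB1 hcon.1
    obtain ⟨k, hk, hki⟩ := other B2 i exB2 hcon.2
    rcases Finset.mem_union.1 hi with h | h
    · exact c.three i g k hir h hg hgi hk hki
    · exact c.swap.three i k g hir h hk hki hg hgi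
  refine ⟨?_, part3⟩
  intro g hg k hk
  have hR : ∀ j, x1 j + x2 j = r → j = g ∨ j = k := by
    intro j hj
    have hm : j ∈ B1 ∪ B2 := by
      rw [Finset.mem_union, hB1, hB2]
      by_contra hcon
      push Not at hcon
      obtain ⟨⟨z, hz⟩, ⟨z', hz'⟩⟩ := hcon
      exact hr ⟨z + z', by push_cast; linarith⟩
    rcases part3 j hm hj with e | e
    · rw [e, Finset.mem_singleton] at hg
      exact Or.inl hg.symm
    · rw [e, Finset.mem_singleton] at hk
      exact Or.inr hk.symm
  obtain ⟨-, -, Dg, Dk, hcol, ⟨C, hC, hkC⟩, ⟨B, hB, hgB⟩⟩ := c.pair g k hg hk hR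
  refine ⟨?_, ⟨C, hC, ?_, ?_⟩, ⟨B, hB, ?_, ?_⟩⟩
  · intro f hf
    have q1 := hcol f hf
    have q2 := c.cov f hf g Dg
    have q3 := c.cov f hf k Dk
    rcases q1 with q1 | q1
    · rcases q2 with q2 | q2
      · exact Or.inr (Or.inr ⟨q1, q2⟩)
      · exact Or.inl ⟨q1, q2⟩
    · rcases q3 with q3 | q3
      · exact Or.inl ⟨q3, q1⟩
      · exact Or.inr (Or.inl ⟨q3, q1⟩)
  · exact (c.cov C hC k Dk).resolve_left hkC
  · exact (hcol C hC).resolve_left hkC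
  · exact (hcol B hB).resolve_right hgB
  · exact (c.cov B hB g Dg).resolve_right hgB
end
end
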